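/- arXiv:0709.4173 — 3 statements merged into one kernel-verified Lean document; each statement's English description precedes it below -/
import Mathlib

section
/- For every complex number s with Re(s) > 0, s ≠ 1/2, and s ≠ 1, one has ∫_0^∞ x^{s-1} (Σ_{m=1}^∞ (-1)^{m-1} e^{-m²x})² dx = (1 - 2^{1-2s}) Γ(s) ζ(2s) - (1 - 2^{1-s}) Γ(s) ζ(s) L(s). -/
open Complex Real MeasureTheory

/-- The Dirichlet beta function: the L-function of the unique nontrivial
Dirichlet character modulo 4. -/
noncomputable def dirichletBeta (s : ℂ) : ℂ :=
  DirichletCharacter.LFunction (ZMod.χ₄.ringHomComp (Int.castRingHom ℂ)) s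

/-- Gaussian integers of norm `n`. -/
def gA (n : ℕ) : Set GaussianInt := {z | z.norm = (n : ℤ)}

/-- Gaussian integers with `p * norm = n`. -/
def gB (p n : ℕ) : Set GaussianInt := {z | (p : ℤ) * z.norm = (n : ℤ)}

lemma gauss_norm_eq (z : GaussianInt) : z.norm = z.re ^ 2 + z.im ^ 2 := by
  rw [Zsqrtd.norm_def]; ring

lemma gA_finite (n : ℕ) : (gA n).Finite := by
  have h : Set.Finite ((fun z : GaussianInt => (z.re, z.im)) '' gA n) := by
    apply Set.Finite.subset ((Set.finite_Icc (-(n:ℤ)) n).prod (Set.finite_Icc (-(n:ℤ)) n))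
    rintro _ ⟨z, hz, rfl⟩
    have hz' : z.re ^ 2 + z.im ^ 2 = (n : ℤ) := by rw [← gauss_norm_eq]; exact hz
    simp only [Set.mem_prod, Set.mem_Icc]
    have h1 := Int.le_self_sq z.re
    have h2 := Int.le_self_sq (-z.re)
    have h3 := Int.le_self_sq z.im
    have h4 := Int.le_self_sq (-z.im)
    have h5 := sq_nonneg z.re
    have h6 := sq_nonneg z.im
    refine ⟨⟨?_, ?_⟩, ⟨?_, ?_⟩⟩ <;> nlinarith
  refine h.of_finite_image ?_
  intro a _ b _ hab
  simp only [Prod.mk.injEq] at hab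
  exact Zsqrtd.ext hab.1 hab.2

lemma gB_ncard (p n : ℕ) (hp : 0 < p) :
    (gB p n).ncard = if p ∣ n then (gA (n / p)).ncard else 0 := by
  split_ifs with h
  · obtain ⟨m, rfl⟩ := h
    rw [Nat.mul_div_cancel_left _ hp]
    congr 1
    ext z
    simp only [gA, gB, Set.mem_ofPred_eq]
    push_cast
    exact mul_right_inj' (by exact_mod_cast hp.ne')
  · have : gB p n = ∅ := by
      ext z
      simp only [gB, Set.mem_ofPred_eq, Set.mem_empty_iff_false, iff_false]
      intro hz
      apply h
      have : (p : ℤ) ∣ (n : ℤ) := ⟨_, hz.symm⟩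
      exact_mod_cast this
    rw [this, Set.ncard_empty]

lemma star_dvd_iff' {a b : GaussianInt} (h : a ∣ star b) : star a ∣ b := by
  obtain ⟨c, hc⟩ := h
  refine ⟨star c, ?_⟩
  rw [← star_mul', ← hc, star_star]

lemma gauss_prime_of_norm {w : GaussianInt} {p : ℕ} (hp : p.Prime) (hw : w.norm = (p : ℤ)) :
    Prime w := by
  rw [← irreducible_iff_prime]
  constructor
  · intro h
    rw [← Zsqrtd.norm_eq_one_iff, hw] at h
    simp only [Int.natAbs_natCast] at h
    exact hp.one_lt.ne' h
  · intro a b hab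
    have h : a.norm.natAbs * b.norm.natAbs = p := by
      rw [← Int.natAbs_mul, ← Zsqrtd.norm_mul, ← hab, hw, Int.natAbs_natCast]
    rw [← Zsqrtd.norm_eq_one_iff, ← Zsqrtd.norm_eq_one_iff]
    have := Nat.prime_mul_iff.1 (h ▸ hp)
    tauto

lemma gA_split {w : GaussianInt} {p : ℕ} (hp : p.Prime) (hw : w.norm = (p : ℤ)) (n : ℕ) :
    gA (p * n) = (w * ·) '' gA n ∪ (star w * ·) '' gA n := by
  have hp0 : (p : ℤ) ≠ 0 := by exact_mod_cast hp.ne_zero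
  ext z
  simp only [gA, Set.mem_ofPred_eq, Set.mem_union, Set.mem_image]
  constructor
  · intro hz
    have hd : w ∣ z * star z := by
      rw [← Zsqrtd.norm_eq_mul_conj, hz]
      push_cast
      have : ((p : ℕ) : GaussianInt) = w * star w := by
        rw [← Zsqrtd.norm_eq_mul_conj, hw]; simp
      rw [this, mul_assoc]
      exact dvd_mul_right _ _
    rcases (gauss_prime_of_norm hp hw).dvd_or_dvd hd with h | h
    · left
      obtain ⟨c, rfl⟩ := h
      refine ⟨c, ?_, rfl⟩
      rw [Zsqrtd.norm_mul, hw] at hz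
      push_cast at hz
      exact mul_left_cancel₀ hp0 hz
    · right
      obtain ⟨c, rfl⟩ := star_dvd_iff' h
      refine ⟨c, ?_, rfl⟩
      rw [Zsqrtd.norm_mul, Zsqrtd.norm_conj, hw] at hz
      push_cast at hz
      exact mul_left_cancel₀ hp0 hz
  · rintro (⟨c, hc, rfl⟩ | ⟨c, hc, rfl⟩)
    · rw [Zsqrtd.norm_mul, hw, hc]; push_cast; rfl
    · rw [Zsqrtd.norm_mul, Zsqrtd.norm_conj, hw, hc]; push_cast; rfl

lemma gauss_star_not_dvd {w : GaussianInt} {p : ℕ} (hp : p.Prime) (h2 : p ≠ 2)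
    (hw : w.norm = (p : ℤ)) : ¬ star w ∣ w := by
  intro h
  have h1 : star w ∣ w + star w := dvd_add h dvd_rfl
  obtain ⟨c, hc⟩ := h1
  have h3 : w + star w = ((2 * w.re : ℤ) : GaussianInt) := by
    ext <;> simp <;> ring
  have h4 : (2 * w.re) * (2 * w.re) = (p : ℤ) * c.norm := by
    rw [← Zsqrtd.norm_intCast (d := -1), ← h3, hc, Zsqrtd.norm_mul, Zsqrtd.norm_conj, hw]
  have hpi : Prime (p : ℤ) := Nat.prime_iff_prime_int.1 hp
  have h5 : (p : ℤ) ∣ 2 * w.re := by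
    rcases hpi.dvd_or_dvd (Dvd.intro _ h4.symm) with h | h <;> exact h
  have h6 : (p : ℤ) ∣ w.re := by
    rcases hpi.dvd_or_dvd h5 with h | h
    · exfalso
      have : p ∣ 2 := by exact_mod_cast h
      exact h2 ((Nat.prime_dvd_prime_iff_eq hp Nat.prime_two).1 this)
    · exact h
  rw [gauss_norm_eq] at hw
  have h7 : (p : ℤ) ∣ w.im := by
    have : (p : ℤ) ∣ w.im ^ 2 := by
      have e : w.im ^ 2 = p - w.re ^ 2 := by linarith
      rw [e]
      exact dvd_sub dvd_rfl (dvd_pow h6 two_ne_zero)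
    exact hpi.dvd_of_dvd_pow this
  obtain ⟨a, ha⟩ := h6
  obtain ⟨b, hb⟩ := h7
  rw [ha, hb] at hw
  have h8 : (p : ℤ) * ((p : ℤ) * (a ^ 2 + b ^ 2)) = p * 1 := by linarith
  have h9 := mul_left_cancel₀ hpi.ne_zero h8
  exact hpi.not_isUnit (IsUnit.of_mul_eq_one _ h9)

lemma ncard_image_mul {w : GaussianInt} (hw : w ≠ 0) (s : Set GaussianInt) :
    ((w * ·) '' s).ncard = s.ncard :=
  Set.ncard_image_of_injective _ (mul_right_injective₀ hw)

lemma gA_ncard_one_mod {p : ℕ} (hp : p.Prime) (h : p % 4 = 1) (n : ℕ) :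
    (gA (p * n)).ncard + (gB p n).ncard = 2 * (gA n).ncard := by
  have := Fact.mk hp
  obtain ⟨a, b, hab⟩ := Nat.Prime.sq_add_sq (p := p) (by omega)
  let w : GaussianInt := ⟨a, b⟩
  have hw : w.norm = (p : ℤ) := by
    rw [gauss_norm_eq, ← hab]; simp [w]
  have hw' : (star w).norm = (p : ℤ) := by rw [Zsqrtd.norm_conj, hw]
  have hP := gauss_prime_of_norm hp hw
  have hP' := gauss_prime_of_norm hp hw'
  have hpw : ((p : ℕ) : GaussianInt) = w * star w := by
    rw [← Zsqrtd.norm_eq_mul_conj, hw]; simp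
  have hp0 : ((p : ℕ) : GaussianInt) ≠ 0 := by
    rw [hpw]; exact mul_ne_zero hP.ne_zero hP'.ne_zero
  have hI : (w * ·) '' gA n ∩ (star w * ·) '' gA n = (((p : ℕ) : GaussianInt) * ·) '' gB p n := by
    ext z
    simp only [Set.mem_inter_iff, Set.mem_image, gA, gB, Set.mem_ofPred_eq]
    constructor
    · rintro ⟨⟨c, hc, rfl⟩, ⟨d, hd, hcd⟩⟩
      have h1 : star w ∣ w * c := ⟨d, hcd.symm⟩
      rcases hP'.dvd_or_dvd h1 with h2 | ⟨e, rfl⟩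
      · exact absurd h2 (gauss_star_not_dvd hp (by rintro rfl; omega) hw)
      · refine ⟨e, ?_, by rw [hpw, mul_assoc]⟩
        rwa [Zsqrtd.norm_mul, hw'] at hc
    · rintro ⟨e, he, rfl⟩
      refine ⟨⟨star w * e, ?_, by rw [hpw, mul_assoc]⟩, ⟨w * e, ?_, by rw [hpw]; ring⟩⟩
      · rw [Zsqrtd.norm_mul, hw', he]
      · rw [Zsqrtd.norm_mul, hw, he]
  have := Set.ncard_union_add_ncard_inter ((w * ·) '' gA n) ((star w * ·) '' gA n)
    ((gA_finite n).image _) ((gA_finite n).image _)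
  rw [hI, ← gA_split hp hw, ncard_image_mul hp0, ncard_image_mul hP.ne_zero,
    ncard_image_mul hP'.ne_zero] at this
  omega

lemma gA_ncard_three_mod {p : ℕ} (hp : p.Prime) (h : p % 4 = 3) (n : ℕ) :
    (gA (p * n)).ncard = (gB p n).ncard := by
  have := Fact.mk hp
  have hP := GaussianInt.prime_of_nat_prime_of_mod_four_eq_three p h
  have hp0 : (p : ℤ) ≠ 0 := by exact_mod_cast hp.ne_zero
  rw [← ncard_image_mul hP.ne_zero (gB p n)]
  congr 1
  ext z
  simp only [Set.mem_image, gA, gB, Set.mem_ofPred_eq]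
  constructor
  · intro hz
    have hd : (p : GaussianInt) ∣ z * star z := by
      rw [← Zsqrtd.norm_eq_mul_conj, hz]
      push_cast
      exact dvd_mul_right _ _
    have hd' : (p : GaussianInt) ∣ z := by
      rcases hP.dvd_or_dvd hd with h | h
      · exact h
      · have := star_dvd_iff' h
        simpa using this
    obtain ⟨c, rfl⟩ := hd'
    refine ⟨c, ?_, rfl⟩
    rw [Zsqrtd.norm_mul, Zsqrtd.norm_natCast, mul_assoc] at hz
    push_cast at hz
    exact mul_left_cancel₀ hp0 hz
  · rintro ⟨c, hc, rfl⟩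
    rw [Zsqrtd.norm_mul, Zsqrtd.norm_natCast, mul_assoc, hc]
    push_cast; rfl

lemma gA_ncard_two (n : ℕ) : (gA (2 * n)).ncard = (gA n).ncard := by
  let w : GaussianInt := ⟨1, 1⟩
  have hw : w.norm = ((2 : ℕ) : ℤ) := by simp [gauss_norm_eq, w]
  have hP := gauss_prime_of_norm Nat.prime_two hw
  rw [gA_split Nat.prime_two hw, Set.union_eq_self_of_subset_right, ncard_image_mul hP.ne_zero]
  rintro _ ⟨z, hz, rfl⟩
  let u : GaussianInt := ⟨0, -1⟩
  refine ⟨u * z, ?_, ?_⟩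
  · simp only [gA, Set.mem_ofPred_eq] at hz ⊢
    rw [Zsqrtd.norm_mul, hz]
    simp [u, gauss_norm_eq]
  · have : star w = w * u := by ext <;> simp [w, u]
    simp only [this, mul_assoc]

lemma gA_zero : (gA 0).ncard = 1 := by
  have : gA 0 = {0} := by
    ext z
    simp only [gA, Set.mem_ofPred_eq, Set.mem_singleton_iff]
    exact_mod_cast GaussianInt.norm_eq_zero
  rw [this, Set.ncard_singleton]

lemma gA_one : (gA 1).ncard = 4 := by
  have : gA 1 = (({⟨1,0⟩, ⟨-1,0⟩, ⟨0,1⟩, ⟨0,-1⟩} : Finset GaussianInt) : Set GaussianInt) := by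
    ext ⟨a, b⟩
    simp only [gA, Set.mem_ofPred_eq, gauss_norm_eq, Finset.coe_insert, Finset.coe_singleton,
      Set.mem_insert_iff, Set.mem_singleton_iff, Zsqrtd.mk.injEq]
    constructor
    · intro h
      push_cast at h
      have h1 : a ≤ 1 := by nlinarith
      have h2 : -1 ≤ a := by nlinarith
      have h3 : b ≤ 1 := by nlinarith
      have h4 : -1 ≤ b := by nlinarith
      interval_cases a <;> interval_cases b <;> simp_all
    · rintro (⟨rfl, rfl⟩ | ⟨rfl, rfl⟩ | ⟨rfl, rfl⟩ | ⟨rfl, rfl⟩) <;> norm_num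
  rw [this, Set.ncard_coe_finset]
  decide

/-- Divisor sum of `χ₄`. -/
def divChi (n : ℕ) : ℤ := ∑ d ∈ n.divisors, ZMod.χ₄ d

lemma divChi_rec {p n : ℕ} (hp : p.Prime) (hn : n ≠ 0) :
    divChi (p * n) = (1 + ZMod.χ₄ p) * divChi n -
      ZMod.χ₄ p * (if p ∣ n then divChi (n / p) else 0) := by
  have key : ∀ m : ℕ, ∑ d ∈ (m.divisors).image (p * ·), ZMod.χ₄ (d : ℕ) = ZMod.χ₄ p * divChi m := by
    intro m
    rw [Finset.sum_image (fun a _ b _ h => Nat.eq_of_mul_eq_mul_left hp.pos h), divChi,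
      Finset.mul_sum]
    refine Finset.sum_congr rfl fun d _ => ?_
    push_cast
    rw [map_mul]
  have hU : (p * n).divisors = n.divisors ∪ (n.divisors).image (p * ·) := by
    ext d
    simp only [Nat.mem_divisors, Finset.mem_union, Finset.mem_image, ne_eq, mul_eq_zero, hn,
      hp.ne_zero, or_self, not_false_eq_true, and_true]
    constructor
    · intro h
      by_cases hpd : p ∣ d
      · obtain ⟨e, rfl⟩ := hpd
        exact Or.inr ⟨e, Nat.dvd_of_mul_dvd_mul_left hp.pos h, rfl⟩
      · exact Or.inl (((Nat.Prime.coprime_iff_not_dvd hp).2 hpd).symm.dvd_of_dvd_mul_left h)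
    · rintro (h | ⟨e, he, rfl⟩)
      · exact h.mul_left p
      · exact Nat.mul_dvd_mul_left p he
  have hI : n.divisors ∩ (n.divisors).image (p * ·) =
      if p ∣ n then (n / p).divisors.image (p * ·) else ∅ := by
    split_ifs with h
    · obtain ⟨m, rfl⟩ := h
      rw [Nat.mul_div_cancel_left _ hp.pos]
      have hm : m ≠ 0 := by rintro rfl; simp at hn
      ext d
      simp only [Nat.mem_divisors, Finset.mem_inter, Finset.mem_image, ne_eq, hn, hm,
        not_false_eq_true, and_true]
      constructor
      · rintro ⟨h1, e, he, rfl⟩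
        exact ⟨e, Nat.dvd_of_mul_dvd_mul_left hp.pos h1, rfl⟩
      · rintro ⟨e, he, rfl⟩
        exact ⟨Nat.mul_dvd_mul_left p he, e, he.mul_left p, rfl⟩
    · ext d
      simp only [Nat.mem_divisors, Finset.mem_inter, Finset.mem_image, Finset.notMem_empty,
        iff_false]
      rintro ⟨h1, e, he, rfl⟩
      exact h (dvd_of_mul_right_dvd h1.1)
  have := Finset.sum_union_inter (s₁ := n.divisors) (s₂ := (n.divisors).image (p * ·))
    (f := fun d : ℕ => ZMod.χ₄ d)
  rw [← hU, hI, key] at this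
  have h3 : ∑ d ∈ (if p ∣ n then (n / p).divisors.image (p * ·) else ∅), ZMod.χ₄ (d : ℕ) =
      ZMod.χ₄ p * (if p ∣ n then divChi (n / p) else 0) := by
    split_ifs
    · exact key _
    · simp
  rw [h3] at this
  change divChi (p * n) + _ = divChi n + _ at this
  linarith

lemma gA_rec {p n : ℕ} (hp : p.Prime) :
    ((gA (p * n)).ncard : ℤ) = (1 + ZMod.χ₄ p) * (gA n).ncard -
      ZMod.χ₄ p * (if p ∣ n then ((gA (n / p)).ncard : ℤ) else 0) := by
  have hB := gB_ncard p n hp.pos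
  have hB' : ((gB p n).ncard : ℤ) = if p ∣ n then ((gA (n / p)).ncard : ℤ) else 0 := by
    rw [hB]; split_ifs <;> simp
  rw [← hB']
  rcases hp.eq_two_or_odd with h | h
  · subst h
    have h0 : ZMod.χ₄ ((2 : ℕ) : ZMod 4) = 0 := by decide
    rw [h0, gA_ncard_two]; ring
  · have h4 : p % 4 = 1 ∨ p % 4 = 3 := by omega
    rcases h4 with h4 | h4
    · rw [ZMod.χ₄_nat_one_mod_four h4]
      have := gA_ncard_one_mod hp h4 n
      have : ((gA (p * n)).ncard : ℤ) + (gB p n).ncard = 2 * (gA n).ncard := by exact_mod_cast this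
      linarith
    · rw [ZMod.χ₄_nat_three_mod_four h4, gA_ncard_three_mod hp h4 n]
      ring

theorem two_squares (n : ℕ) (hn : n ≠ 0) : ((gA n).ncard : ℤ) = 4 * divChi n := by
  induction n using Nat.strong_induction_on with
  | _ n ih =>
    by_cases h1 : n = 1
    · subst h1
      rw [gA_one]; simp [divChi]
    · have hp := Nat.minFac_prime h1
      obtain ⟨m, hm⟩ := Nat.minFac_dvd n
      set p := n.minFac
      have hm0 : m ≠ 0 := by rintro rfl; simp at hm; exact hn hm
      have hlt : m < n := by
        rw [hm]; exact lt_mul_of_one_lt_left (Nat.pos_of_ne_zero hm0) hp.one_lt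
      rw [hm, gA_rec hp, divChi_rec hp hm0, ih m hlt hm0]
      split_ifs with h
      · have h2 : m / p ≠ 0 :=
          (Nat.div_pos (Nat.le_of_dvd (Nat.pos_of_ne_zero hm0) h) hp.pos).ne'
        rw [ih (m / p) ((Nat.div_le_self _ _).trans_lt hlt) h2]
        ring
      · ring

lemma divChi_two_mul (n : ℕ) : divChi (2 * n) = divChi n := by
  by_cases hn : n = 0
  · subst hn; rfl
  · rw [divChi_rec Nat.prime_two hn]
    have h0 : ZMod.χ₄ ((2 : ℕ) : ZMod 4) = 0 := by decide
    rw [h0]; ring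

/-- The alternating theta-type sum. -/
noncomputable def altS (x : ℝ) : ℝ :=
  ∑' m : ℕ, (-1 : ℝ) ^ m * Real.exp (-((m : ℝ) + 1) ^ 2 * x)

lemma summable_exp_sq {x : ℝ} (hx : 0 < x) :
    Summable fun m : ℕ => Real.exp (-((m : ℝ) + 1) ^ 2 * x) := by
  refine Summable.of_nonneg_of_le (fun _ => (Real.exp_pos _).le) (fun m => ?_)
    (Real.summable_exp_nat_mul_iff.2 (neg_lt_zero.2 hx))
  apply Real.exp_le_exp.2
  have : (0 : ℝ) ≤ m := Nat.cast_nonneg m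
  nlinarith [mul_nonneg (by positivity : (0:ℝ) ≤ (m:ℝ)^2 + m + 1) hx.le]

lemma hasSum_altS {x : ℝ} (hx : 0 < x) :
    HasSum (fun m : ℕ => (-1 : ℝ) ^ m * Real.exp (-((m : ℝ) + 1) ^ 2 * x)) (altS x) :=
  (summable_exp_sq hx).alternating.hasSum

lemma abs_altS_le {x : ℝ} (hx : 0 < x) : |altS x| ≤ Real.exp (-x) := by
  have hanti : Antitone fun m : ℕ => Real.exp (-((m : ℝ) + 1) ^ 2 * x) := by
    intro a b hab
    apply Real.exp_le_exp.2
    have h1 : (a : ℝ) ≤ b := by exact_mod_cast hab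
    have h0 : (0 : ℝ) ≤ a := Nat.cast_nonneg a
    have : ((a : ℝ) + 1) ^ 2 ≤ ((b : ℝ) + 1) ^ 2 := by gcongr
    nlinarith
  have := alternating_series_error_bound _ hanti (summable_exp_sq hx) 0
  simpa [altS] using this

/-- bilateral theta terms -/
noncomputable def thT (x : ℝ) (n : ℤ) : ℝ := (-1 : ℝ) ^ n.natAbs * Real.exp (-(n : ℝ) ^ 2 * x)

lemma hasSum_thT {x : ℝ} (hx : 0 < x) : HasSum (thT x) (1 - 2 * altS x) := by
  have h := (hasSum_altS hx).neg
  have h1 : HasSum (fun n : ℕ => thT x (n + 1)) (-altS x) := by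
    refine h.congr_fun ?_ |> fun h => h
    intro n
    have : ((n : ℤ) + 1).natAbs = n + 1 := by omega
    simp only [thT, this, pow_succ]
    push_cast
    ring
  have h2 : HasSum (fun n : ℕ => thT x (-(n + 1))) (-altS x) := by
    convert! h1 using 2 with n
    simp only [thT, Int.natAbs_neg]
    push_cast
    ring_nf
  have h3 := HasSum.of_add_one_of_neg_add_one h1 h2
  convert! h3 using 1
  simp [thT]; ring

lemma summable_norm_thT {x : ℝ} (hx : 0 < x) : Summable fun n => ‖thT x n‖ :=
  (hasSum_thT hx).summable.norm

lemma neg_one_pow_sq' (k : ℕ) : (-1 : ℝ) ^ (k ^ 2) = (-1) ^ k := by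
  rcases Nat.even_or_odd k with h | h
  · rw [h.neg_one_pow, (h.pow_of_ne_zero two_ne_zero).neg_one_pow]
  · rw [h.neg_one_pow, h.pow.neg_one_pow]

/-- `ℤ × ℤ` as Gaussian integers. -/
def gEquiv : GaussianInt ≃ ℤ × ℤ where
  toFun z := (z.re, z.im)
  invFun p := ⟨p.1, p.2⟩
  left_inv _ := rfl
  right_inv _ := rfl

lemma hasSum_gauss {x : ℝ} (hx : 0 < x) :
    HasSum (fun z : GaussianInt => (-1 : ℝ) ^ z.norm.natAbs * Real.exp (-(z.norm.natAbs : ℝ) * x))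
      ((1 - 2 * altS x) ^ 2) := by
  have h := (hasSum_thT hx).mul (hasSum_thT hx)
    (summable_mul_of_summable_norm (summable_norm_thT hx) (summable_norm_thT hx))
  rw [← gEquiv.hasSum_iff, ← sq] at h
  convert! h using 2 with z
  have e : z.norm.natAbs = z.re.natAbs ^ 2 + z.im.natAbs ^ 2 := by
    zify
    rw [abs_of_nonneg (GaussianInt.norm_nonneg z), gauss_norm_eq, sq_abs, sq_abs]
  have e' : (z.norm.natAbs : ℝ) = (z.re : ℝ) ^ 2 + (z.im : ℝ) ^ 2 := by
    rw [e]; push_cast; simp [Nat.cast_natAbs]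
  rw [e', e]
  simp only [Function.comp, gEquiv, Equiv.coe_fn_mk, thT, pow_add, neg_one_pow_sq']
  rw [show -((z.re : ℝ) ^ 2 + (z.im : ℝ) ^ 2) * x = -(z.re : ℝ) ^ 2 * x + -(z.im : ℝ) ^ 2 * x by ring,
    Real.exp_add]
  ring

lemma hasSum_ncard {x : ℝ} (hx : 0 < x) :
    HasSum (fun n : ℕ => ((gA n).ncard : ℝ) * ((-1 : ℝ) ^ n * Real.exp (-(n : ℝ) * x)))
      ((1 - 2 * altS x) ^ 2) := by
  have h := hasSum_gauss hx
  rw [← (Equiv.sigmaFiberEquiv (fun z : GaussianInt => z.norm.natAbs)).hasSum_iff] at h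
  refine h.sigma fun n => ?_
  have hset : gA n = {z : GaussianInt | z.norm.natAbs = n} := by
    ext z
    have := GaussianInt.norm_nonneg z
    simp only [gA, Set.mem_ofPred_eq]
    omega
  have hfin : Finite {z : GaussianInt // z.norm.natAbs = n} := by
    have := gA_finite n
    rw [hset] at this
    exact this
  have := Fintype.ofFinite {z : GaussianInt // z.norm.natAbs = n}
  have hcard : (gA n).ncard = Fintype.card {z : GaussianInt // z.norm.natAbs = n} := by
    rw [hset, ← Nat.card_eq_fintype_card]; rfl
  convert! hasSum_fintype _ using 1
  rw [Finset.sum_congr rfl (g := fun _ => (-1 : ℝ) ^ n * Real.exp (-(n : ℝ) * x))]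
  · rw [Finset.sum_const, Finset.card_univ, hcard, nsmul_eq_mul]
  · rintro ⟨z, hz⟩ _
    simp only [Function.comp, Equiv.sigmaFiberEquiv_apply, hz]

lemma hasSum_divChi {x : ℝ} (hx : 0 < x) :
    HasSum (fun n : ℕ => (-1 : ℝ) ^ n * (divChi n : ℝ) * Real.exp (-(n : ℝ) * x))
      (altS x ^ 2 - altS x) := by
  have h := (hasSum_ncard hx).update 0 0
  have h4 := h.mul_left (1 / 4)
  convert! h4 using 1
  · ext n
    by_cases hn : n = 0
    · subst hn; simp [divChi]
    · have := two_squares n hn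
      have : ((gA n).ncard : ℝ) = 4 * (divChi n : ℝ) := by exact_mod_cast this
      simp only [Function.update_of_ne hn, this]
      ring
  · simp [gA_zero]; ring

lemma LSeries_alt {g : ℕ → ℂ} (hg : ∀ n, g (2 * n) = g n) {s : ℂ} (hs : LSeriesSummable g s) :
    LSeriesHasSum (fun n => (-1) ^ n * g n) s (((2 : ℂ) ^ (1 - s) - 1) * LSeries g s) := by
  have hinj : Function.Injective (fun n : ℕ => 2 * n) := fun a b h => by simpa using h
  have h1 : HasSum (LSeries.term g s) (LSeries g s) := hs.hasSum
  have h2 : HasSum (fun n : ℕ => LSeries.term g s (2 * n)) ((2 : ℂ) ^ (-s) * LSeries g s) := by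
    convert! h1.mul_left ((2 : ℂ) ^ (-s)) using 2 with n
    by_cases hn : n = 0
    · subst hn; simp
    · rw [LSeries.term_of_ne_zero (by omega), LSeries.term_of_ne_zero hn, hg]
      push_cast
      have := Complex.natCast_mul_natCast_cpow 2 n s
      push_cast at this
      rw [this, Complex.cpow_neg]
      field_simp
  have h3 : HasSum (fun n : ℕ => if Even n then LSeries.term g s n else 0)
      ((2 : ℂ) ^ (-s) * LSeries g s) := by
    rw [← hinj.hasSum_iff]
    · convert! h2 using 2 with n
      simp
    · intro n hn
      have : ¬ Even n := by
        rintro ⟨k, hk⟩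
        exact hn ⟨k, by simp; omega⟩
      simp [this]
  have h4 := (h3.mul_left 2).sub h1
  unfold LSeriesHasSum
  convert! h4 using 1
  · ext n
    by_cases hn : n = 0
    · subst hn; simp
    · rw [LSeries.term_of_ne_zero hn, LSeries.term_of_ne_zero hn]
      split_ifs with h
      · rw [h.neg_one_pow]; ring
      · rw [(Nat.not_even_iff_odd.1 h).neg_one_pow]; ring
  · rw [sub_eq_add_neg 1 s, Complex.cpow_add _ _ two_ne_zero, Complex.cpow_one]; ring

/-- the function `(-1)^n` on `ZMod 2`. -/
noncomputable def altPhi (j : ZMod 2) : ℂ := if j = 0 then 1 else -1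

lemma altPhi_nat (n : ℕ) : altPhi n = (-1) ^ n := by
  unfold altPhi
  split_ifs with h <;> rw [ZMod.natCast_eq_zero_iff_even] at h
  · rw [h.neg_one_pow]
  · rw [(Nat.not_even_iff_odd.1 h).neg_one_pow]

lemma LSeries_alt_one {s : ℂ} (hs : 1 < s.re) :
    LSeriesHasSum (fun n => (-1) ^ n) s (((2 : ℂ) ^ (1 - s) - 1) * riemannZeta s) := by
  have := LSeries_alt (g := 1) (fun n => rfl) (LSeriesSummable_one_iff.2 hs)
  rw [LSeries_one_eq_riemannZeta hs] at this
  simpa using this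

lemma altPhi_diff : Differentiable ℂ (ZMod.LFunction altPhi) := by
  apply ZMod.differentiable_LFunction_of_sum_zero
  have : (Finset.univ : Finset (ZMod 2)) = {0, 1} := by decide
  rw [this, Finset.sum_pair (by decide)]
  simp [altPhi]

lemma altPhi_eq_of_re {s : ℂ} (hs : 1 < s.re) :
    ZMod.LFunction altPhi s = ((2 : ℂ) ^ (1 - s) - 1) * riemannZeta s := by
  rw [ZMod.LFunction_eq_LSeries _ hs, ← (LSeries_alt_one hs).LSeries_eq]
  simp_rw [altPhi_nat]

lemma altPhi_eq {s : ℂ} (hs : s ≠ 1) :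
    ZMod.LFunction altPhi s = ((2 : ℂ) ^ (1 - s) - 1) * riemannZeta s := by
  have hU : IsOpen ({1}ᶜ : Set ℂ) := isOpen_compl_singleton
  have h1 : AnalyticOnNhd ℂ (ZMod.LFunction altPhi) ({1}ᶜ : Set ℂ) :=
    altPhi_diff.differentiableOn.analyticOnNhd hU
  have h2 : AnalyticOnNhd ℂ (fun s => ((2 : ℂ) ^ (1 - s) - 1) * riemannZeta s) ({1}ᶜ : Set ℂ) := by
    refine DifferentiableOn.analyticOnNhd (fun z hz => ?_) hU
    have hz' : DifferentiableAt ℂ riemannZeta z := differentiableAt_riemannZeta hz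
    have h3 : DifferentiableAt ℂ (fun s : ℂ => (2 : ℂ) ^ (1 - s)) z :=
      DifferentiableAt.const_cpow (by fun_prop) (Or.inl two_ne_zero)
    exact ((h3.sub_const 1).mul hz').differentiableWithinAt
  refine h1.eqOn_of_preconnected_of_eventuallyEq h2
    (isConnected_compl_singleton_of_one_lt_rank (by simp) 1).isPreconnected
    (z₀ := 2) (by simp) ?_ hs
  have : {z : ℂ | 1 < z.re} ∈ nhds (2 : ℂ) :=
    (isOpen_lt continuous_const Complex.continuous_re).mem_nhds (by simp)
  filter_upwards [this] with z hz using altPhi_eq_of_re hz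

/-- complex version of `χ₄`. -/
noncomputable abbrev chiC : DirichletCharacter ℂ 4 := ZMod.χ₄.ringHomComp (Int.castRingHom ℂ)

lemma chiC_apply (n : ZMod 4) : chiC n = ((ZMod.χ₄ n : ℤ) : ℂ) := rfl

lemma dirichletBeta_diff : Differentiable ℂ dirichletBeta := by
  refine DirichletCharacter.differentiable_LFunction (χ := chiC) ?_
  intro h
  have h1 : chiC 3 = (1 : DirichletCharacter ℂ 4) 3 := by rw [h]
  rw [chiC_apply, MulChar.one_apply (by decide)] at h1
  have : ZMod.χ₄ 3 = -1 := by decide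
  rw [this] at h1
  norm_num at h1

lemma divChi_conv : LSeries.convolution 1 (fun n : ℕ => chiC n) = fun n : ℕ => (divChi n : ℂ) := by
  ext n
  rw [LSeries.convolution_def]
  simp only [Pi.one_apply, one_mul, divChi]
  rw [Nat.sum_divisorsAntidiagonal' (f := fun _ b => chiC (b : ℕ))]
  push_cast
  rfl

lemma LSeries_divChi {s : ℂ} (hs : 1 < s.re) :
    LSeriesHasSum (fun n => (-1) ^ n * (divChi n : ℂ)) s
      (((2 : ℂ) ^ (1 - s) - 1) * (riemannZeta s * dirichletBeta s)) := by
  have hs1 := LSeriesSummable_one_iff.2 hs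
  have hs2 := DirichletCharacter.LSeriesSummable_of_one_lt_re chiC hs
  have hsum := hs1.convolution hs2
  have heq := LSeries_convolution' hs1 hs2
  rw [divChi_conv] at hsum heq
  have := LSeries_alt (fun n => by rw [divChi_two_mul]) hsum
  rwa [heq, LSeries_one_eq_riemannZeta hs,
    ← DirichletCharacter.LFunction_eq_LSeries chiC hs] at this

lemma altS_aesm : AEStronglyMeasurable altS (volume.restrict (Set.Ioi (0 : ℝ))) := by
  refine aestronglyMeasurable_of_tendsto_ae Filter.atTop
    (f := fun (N : ℕ) (x : ℝ) => ∑ m ∈ Finset.range N,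
      (-1 : ℝ) ^ m * Real.exp (-((m : ℝ) + 1) ^ 2 * x)) (fun N => ?_) ?_
  · exact (by fun_prop : Continuous fun x : ℝ => ∑ m ∈ Finset.range N,
      (-1 : ℝ) ^ m * Real.exp (-((m : ℝ) + 1) ^ 2 * x)).aestronglyMeasurable
  · filter_upwards [ae_restrict_mem measurableSet_Ioi] with x hx
    exact (hasSum_altS hx).tendsto_sum_nat

lemma mellin_aux {g : ℝ → ℝ} (hm : AEStronglyMeasurable g (volume.restrict (Set.Ioi (0 : ℝ))))
    (hb : ∀ x > 0, |g x| ≤ Real.exp (-x)) {s : ℂ} (hs : 0 < s.re) :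
    MellinConvergent (fun x => (g x : ℂ)) s ∧
      DifferentiableAt ℂ (mellin (fun x => (g x : ℂ))) s := by
  have hint : IntegrableOn (fun x => (g x : ℂ)) (Set.Ioi 0) := by
    refine Integrable.mono' (g := fun x => Real.exp (-x)) (integrableOn_exp_neg_Ioi 0)
      (Complex.continuous_ofReal.comp_aestronglyMeasurable hm) ?_
    filter_upwards [ae_restrict_mem measurableSet_Ioi] with x hx
    simpa using hb x hx
  have h1 : (fun x => (g x : ℂ)) =O[Filter.atTop] fun t => Real.exp (-1 * t) := by
    refine Asymptotics.IsBigO.of_bound 1 ?_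
    filter_upwards [Filter.eventually_gt_atTop 0] with x hx
    simpa using hb x hx
  have h2 : (fun x => (g x : ℂ)) =O[nhdsWithin 0 (Set.Ioi 0)] (fun x : ℝ => x ^ (-(0 : ℝ))) := by
    refine Asymptotics.IsBigO.of_bound 1 ?_
    filter_upwards [self_mem_nhdsWithin] with x hx
    have : Real.exp (-x) ≤ 1 := Real.exp_le_one_iff.2 (by simpa using (le_of_lt hx))
    simpa using (hb x hx).trans this
  exact ⟨mellinConvergent_of_isBigO_rpow_exp one_pos hint.locallyIntegrableOn h1 h2 hs,
    mellin_differentiableAt_of_isBigO_rpow_exp one_pos hint.locallyIntegrableOn h1 h2 hs⟩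

lemma altS_sq_le {x : ℝ} (hx : 0 < x) : |altS x ^ 2| ≤ Real.exp (-x) := by
  have h := abs_altS_le hx
  have h1 : Real.exp (-x) ≤ 1 := Real.exp_le_one_iff.2 (by linarith)
  rw [abs_pow]
  nlinarith [abs_nonneg (altS x)]

lemma mellin_altS {s : ℂ} (hs : 1 < s.re) :
    mellin (fun x => (altS x : ℂ)) s =
      -(Complex.Gamma s * (((2 : ℂ) ^ (1 - 2 * s) - 1) * riemannZeta (2 * s))) := by
  have hs2 : 1 < (2 * s).re := by simp; linarith
  have key := LSeries_alt_one hs2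
  unfold LSeriesHasSum at key
  have key' : HasSum (fun n : ℕ => LSeries.term (fun n => (-1) ^ n) (2 * s) (n + 1))
      (((2 : ℂ) ^ (1 - 2 * s) - 1) * riemannZeta (2 * s)) := by
    have := (hasSum_nat_add_iff' 1).2 key
    simpa using this
  have hcpow : ∀ m : ℕ, ((((m : ℝ) + 1) ^ 2 : ℝ) : ℂ) ^ s = ((m + 1 : ℕ) : ℂ) ^ (2 * s) := by
    intro m
    have h0 : (0 : ℝ) ≤ (m : ℝ) + 1 := by positivity
    rw [sq, Complex.ofReal_mul, Complex.mul_cpow_ofReal_nonneg h0 h0, two_mul,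
      Complex.cpow_add _ _ (by exact_mod_cast Nat.succ_ne_zero m)]
    push_cast; rfl
  have hM := hasSum_mellin (a := fun m : ℕ => (-1 : ℂ) ^ m) (p := fun m : ℕ => ((m : ℝ) + 1) ^ 2)
    (F := fun x => (altS x : ℂ)) (s := s) (fun m => Or.inr (by positivity)) (by linarith)
    (fun t ht => by
      have := Complex.hasSum_ofReal.2 (hasSum_altS ht)
      convert! this using 2 with m
      push_cast; rfl)
    (by
      refine key'.summable.norm.congr fun m => ?_
      rw [LSeries.term_of_ne_zero (Nat.succ_ne_zero m), norm_div, ← hcpow m,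
        Complex.norm_cpow_eq_rpow_re_of_pos (by positivity)]
      simp)
  have h3 := (key'.mul_left (Complex.Gamma s)).neg
  refine hM.unique ?_
  convert! h3 using 2 with m
  rw [LSeries.term_of_ne_zero (Nat.succ_ne_zero m), ← hcpow m, Nat.succ_eq_add_one, pow_succ (-1 : ℂ) m]
  push_cast
  ring

lemma mellin_divChi {s : ℂ} (hs : 1 < s.re) :
    mellin (fun x => ((altS x ^ 2 : ℝ) : ℂ) - (altS x : ℂ)) s =
      Complex.Gamma s * (((2 : ℂ) ^ (1 - s) - 1) * (riemannZeta s * dirichletBeta s)) := by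
  have key := LSeries_divChi hs
  unfold LSeriesHasSum at key
  have hz : divChi 0 = 0 := rfl
  have hM := hasSum_mellin (a := fun n : ℕ => (-1 : ℂ) ^ n * (divChi n : ℂ)) (p := fun n : ℕ => (n : ℝ))
    (F := fun x => ((altS x ^ 2 : ℝ) : ℂ) - (altS x : ℂ)) (s := s)
    (fun m => by
      rcases Nat.eq_zero_or_pos m with rfl | h
      · left; simp [hz]
      · right; exact_mod_cast h) (by linarith)
    (fun t ht => by
      have := Complex.hasSum_ofReal.2 (hasSum_divChi ht)
      convert! this using 2 with m
      · push_cast; rfl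
      · push_cast; rfl)
    (by
      refine key.summable.norm.congr fun m => ?_
      rcases Nat.eq_zero_or_pos m with rfl | h
      · simp [hz]
      · rw [LSeries.term_of_ne_zero h.ne', norm_div, Complex.norm_natCast_cpow_of_pos h])
  have h3 := key.mul_left (Complex.Gamma s)
  refine hM.unique ?_
  convert! h3 using 2 with m
  rcases Nat.eq_zero_or_pos m with rfl | h
  · simp [hz]
  · rw [LSeries.term_of_ne_zero h.ne']
    push_cast
    ring

lemma mellin_main {s : ℂ} (hs : 0 < s.re) :
    mellin (fun x => ((altS x ^ 2 : ℝ) : ℂ)) s =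
      Complex.Gamma s * (ZMod.LFunction altPhi s * dirichletBeta s) -
        Complex.Gamma s * ZMod.LFunction altPhi (2 * s) := by
  have hU : IsOpen {z : ℂ | 0 < z.re} := isOpen_lt continuous_const Complex.continuous_re
  have hm2 : AEStronglyMeasurable (fun x => altS x ^ 2) (volume.restrict (Set.Ioi (0 : ℝ))) :=
    altS_aesm.pow 2
  have h1 : AnalyticOnNhd ℂ (mellin (fun x => ((altS x ^ 2 : ℝ) : ℂ))) {z : ℂ | 0 < z.re} :=
    DifferentiableOn.analyticOnNhd (fun z hz =>
      (mellin_aux hm2 (fun x hx => altS_sq_le hx) hz).2.differentiableWithinAt) hU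
  have h2 : AnalyticOnNhd ℂ (fun s => Complex.Gamma s * (ZMod.LFunction altPhi s * dirichletBeta s) -
        Complex.Gamma s * ZMod.LFunction altPhi (2 * s)) {z : ℂ | 0 < z.re} := by
    refine DifferentiableOn.analyticOnNhd (fun z hz => ?_) hU
    have hG : DifferentiableAt ℂ Complex.Gamma z := by
      refine Complex.differentiableAt_Gamma _ fun m h => ?_
      have hz' : 0 < z.re := hz
      rw [h] at hz'
      simp at hz'
      have : (0 : ℝ) ≤ m := Nat.cast_nonneg m
      linarith
    have hA : DifferentiableAt ℂ (fun s => ZMod.LFunction altPhi (2 * s)) z :=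
      DifferentiableAt.comp z (f := fun s : ℂ => 2 * s) (altPhi_diff _) (by fun_prop)
    exact ((hG.mul ((altPhi_diff z).mul (dirichletBeta_diff z))).sub
      (hG.mul hA)).differentiableWithinAt
  refine h1.eqOn_of_preconnected_of_eventuallyEq h2
    (convex_halfSpace_re_gt 0).isPreconnected (z₀ := 2) (by simp) ?_ hs
  have : {z : ℂ | 1 < z.re} ∈ nhds (2 : ℂ) :=
    (isOpen_lt continuous_const Complex.continuous_re).mem_nhds (by simp)
  filter_upwards [this] with z hz
  have hz : 1 < z.re := hz
  have hz2 : 1 < (2 * z).re := by simp; linarith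
  have hsub := (hasMellin_sub (mellin_aux hm2 (fun x hx => altS_sq_le hx) (s := z) (by linarith)).1
    (mellin_aux altS_aesm (fun x hx => abs_altS_le hx) (s := z) (by linarith)).1).2
  rw [mellin_divChi hz, mellin_altS hz] at hsub
  rw [altPhi_eq_of_re hz, altPhi_eq_of_re hz2]
  linear_combination -hsub

/-- For `Re(s) > 0`, `s ≠ 1/2`, `s ≠ 1`:
`∫_0^∞ x^{s-1} (Σ_{m=1}^∞ (-1)^{m-1} e^{-m²x})² dx
  = (1 - 2^{1-2s}) Γ(s) ζ(2s) - (1 - 2^{1-s}) Γ(s) ζ(s) L(s)`. -/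
theorem glasser_mellin (s : ℂ) (hs : 0 < s.re) (hs2 : s ≠ 1 / 2) (hs1 : s ≠ 1) :
    ∫ x in Set.Ioi (0 : ℝ), (x : ℂ) ^ (s - 1) *
        ((∑' m : ℕ, (-1 : ℝ) ^ m * Real.exp (-((m : ℝ) + 1) ^ 2 * x) : ℝ) : ℂ) ^ 2 =
      (1 - (2 : ℂ) ^ (1 - 2 * s)) * Complex.Gamma s * riemannZeta (2 * s) -
        (1 - (2 : ℂ) ^ (1 - s)) * Complex.Gamma s * riemannZeta s * dirichletBeta s := by
  have h := mellin_main hs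
  have h2 : (2 * s) ≠ 1 := by
    intro h; apply hs2; linear_combination h / 2
  rw [altPhi_eq hs1, altPhi_eq h2] at h
  have e : ∫ x in Set.Ioi (0 : ℝ), (x : ℂ) ^ (s - 1) *
        ((∑' m : ℕ, (-1 : ℝ) ^ m * Real.exp (-((m : ℝ) + 1) ^ 2 * x) : ℝ) : ℂ) ^ 2 =
      mellin (fun x => ((altS x ^ 2 : ℝ) : ℂ)) s := by
    simp only [mellin, smul_eq_mul, altS, Complex.ofReal_pow]
  rw [e, h]
  ring
end

section
/- For every complex number s with Re(s) > 0 and s ≠ 1, one has ∫_0^∞ x^{s-1} · ¼ (1 - (Σ_{n∈ℤ} (-1)^n e^{-n²x})²) dx = (1 - 2^{1-s}) Γ(s) ζ(s) L(s); equivalently, Γ(s) π^{-s} ζ(s) L(s) = (π^{-s}/(1 - 2^{1-s})) ∫_0^∞ x^{s-1} · ¼ (1 - θ₄²(0 | ix/π)) dx when additionally 2^{1-s} ≠ 1. -/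
open Complex Real MeasureTheory

/-- The theta value `θ₄(0 | ix/π) = Σ_{n∈ℤ} (-1)^n e^{-n²x}`. -/
noncomputable def theta4 (x : ℝ) : ℝ := ∑' n : ℤ, (-1 : ℝ) ^ n * Real.exp (-(n : ℝ) ^ 2 * x)

namespace TwoSq

/-- number of Gaussian integers of norm `n` -/
noncomputable def f (n : ℕ) : ℕ := Set.ncard {z : GaussianInt | z.norm = (n : ℤ)}

/-- divisor sum of `χ₄` -/
def g (n : ℕ) : ℤ := ∑ d ∈ n.divisors, ZMod.χ₄ (d : ZMod 4)

lemma norm_eq (z : GaussianInt) : z.norm = z.re ^ 2 + z.im ^ 2 := by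
  rw [Zsqrtd.norm_def]; ring

lemma finite_norm (n : ℕ) : {z : GaussianInt | z.norm = (n : ℤ)}.Finite := by
  have h : Set.Finite ((fun z : GaussianInt => (z.re, z.im)) ⁻¹'
      (Set.Icc (-(n:ℤ)) n ×ˢ Set.Icc (-(n:ℤ)) n)) := by
    apply Set.Finite.preimage
    · intro a _ b _ hab
      simp only [Prod.mk.injEq] at hab
      exact Zsqrtd.ext hab.1 hab.2
    · exact (Set.finite_Icc _ _).prod (Set.finite_Icc _ _)
  refine h.subset fun z hz => ?_
  simp only [Set.mem_ofPred_eq, norm_eq] at hz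
  simp only [Set.mem_preimage, Set.mem_prod, Set.mem_Icc]
  refine ⟨⟨?_, ?_⟩, ?_, ?_⟩ <;> nlinarith [sq_nonneg z.re, sq_nonneg z.im, sq_nonneg (z.re+1), sq_nonneg (z.re-1), sq_nonneg (z.im+1), sq_nonneg (z.im-1)]

lemma count_mul (w : GaussianInt) (k : ℕ) (hk : k ≠ 0) (hw : w.norm = k) (m : ℕ) :
    Set.ncard {z : GaussianInt | z.norm = ((k * m : ℕ) : ℤ) ∧ w ∣ z} = f m := by
  have hw0 : w ≠ 0 := by
    rintro rfl
    simp at hw; omega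
  have : {z : GaussianInt | z.norm = ((k * m : ℕ) : ℤ) ∧ w ∣ z} =
      (fun z => w * z) '' {z : GaussianInt | z.norm = (m : ℤ)} := by
    ext z
    constructor
    · rintro ⟨h1, y, rfl⟩
      refine ⟨y, ?_, rfl⟩
      rw [Zsqrtd.norm_mul, hw] at h1
      push_cast at h1
      exact mul_left_cancel₀ (by exact_mod_cast hk) h1
    · rintro ⟨y, hy, rfl⟩
      refine ⟨?_, dvd_mul_right _ _⟩
      rw [Set.mem_ofPred_eq] at hy
      simp [Zsqrtd.norm_mul, hw, hy]
  rw [this, Set.ncard_image_of_injective _ (mul_right_injective₀ hw0), f]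

lemma count_p (p : ℕ) (hp : p.Prime) (m : ℕ) :
    Set.ncard {z : GaussianInt | z.norm = ((p * m : ℕ) : ℤ) ∧ (p : GaussianInt) ∣ z} =
      if p ∣ m then f (m / p) else 0 := by
  split_ifs with h
  · obtain ⟨k, rfl⟩ := h
    rw [Nat.mul_div_cancel_left _ hp.pos, ← mul_assoc]
    exact count_mul _ _ (mul_ne_zero hp.ne_zero hp.ne_zero) (by simp [Zsqrtd.norm_natCast]) k
  · rw [Set.ncard_eq_zero ((finite_norm _).subset fun z hz => hz.1), Set.eq_empty_iff_forall_notMem]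
    rintro z ⟨h1, y, rfl⟩
    rw [Zsqrtd.norm_mul, Zsqrtd.norm_natCast] at h1
    push_cast at h1
    rw [mul_assoc] at h1
    have := mul_left_cancel₀ (by exact_mod_cast hp.ne_zero) h1
    exact h (Int.natCast_dvd_natCast.mp ⟨_, this.symm⟩)

lemma dvd_norm_star (z : GaussianInt) (k : ℕ) (h : (k : ℤ) ∣ z.norm) :
    (k : GaussianInt) ∣ z * star z := by
  obtain ⟨c, hc⟩ := h
  refine ⟨(c : GaussianInt), ?_⟩
  rw [← Zsqrtd.norm_eq_mul_conj, hc]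
  push_cast; rfl

lemma star_dvd {a b : GaussianInt} (h : a ∣ b) : star a ∣ star b := by
  obtain ⟨c, rfl⟩ := h
  exact ⟨star c, by rw [star_mul, mul_comm]⟩

lemma f_two (m : ℕ) : f (2 * m) = f m := by
  rw [← count_mul ⟨1, 1⟩ 2 (by norm_num) (by simp [norm_eq]) m, f]
  congr 1
  ext z
  simp only [Set.mem_ofPred_eq]
  refine ⟨fun h => ⟨h, ?_⟩, fun h => h.1⟩
  rw [norm_eq] at h
  have h2 : (z.re + z.im) % 2 = 0 := by
    have : Even (z.re ^ 2 + z.im ^ 2) := by rw [h]; simp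
    rw [← Int.even_iff]
    simpa [Int.even_add, Int.even_pow] using this
  refine ⟨⟨(z.re + z.im) / 2, (z.im - z.re) / 2⟩, ?_⟩
  ext <;> simp <;> omega

lemma f_three (p : ℕ) (hp : p.Prime) (h3 : p % 4 = 3) (m : ℕ) :
    f (p * m) = if p ∣ m then f (m / p) else 0 := by
  rw [← count_p p hp m, f]
  congr 1
  ext z
  simp only [Set.mem_ofPred_eq]
  refine ⟨fun h => ⟨h, ?_⟩, fun h => h.1⟩
  have := Fact.mk hp
  have hpr := GaussianInt.prime_of_nat_prime_of_mod_four_eq_three p h3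
  have hd := dvd_norm_star z p (by rw [h]; push_cast; exact dvd_mul_right _ _)
  rcases hpr.dvd_or_dvd hd with h | h
  · exact h
  · simpa using star_dvd h

lemma f_one_mod (p : ℕ) (hp : p.Prime) (h1 : p % 4 = 1) (m : ℕ) :
    f (p * m) + (if p ∣ m then f (m / p) else 0) = 2 * f m := by
  have := Fact.mk hp
  obtain ⟨a, b, hab⟩ := Nat.Prime.sq_add_sq (p := p) (by omega)
  let w : GaussianInt := ⟨a, b⟩
  have hw : w.norm = p := by rw [norm_eq]; simp only [w]; exact_mod_cast hab
  have hws : (star w).norm = p := by rw [Zsqrtd.norm_conj, hw]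
  have hpw : (p : GaussianInt) = w * star w := by
    rw [← Zsqrtd.norm_eq_mul_conj, hw]; simp
  have hwp : Prime w := by
    rw [← irreducible_iff_prime]
    constructor
    · intro hu
      have := Zsqrtd.norm_eq_one_iff.mpr hu
      rw [hw] at this
      simp at this
      exact hp.one_lt.ne' this
    · intro x y hxy
      have : x.norm.natAbs * y.norm.natAbs = p := by
        rw [← Int.natAbs_mul, ← Zsqrtd.norm_mul, ← hxy, hw]; simp
      have hx : x.norm.natAbs ∣ p := ⟨_, this.symm⟩
      rcases (Nat.dvd_prime hp).mp hx with h | h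
      · exact Or.inl (Zsqrtd.norm_eq_one_iff.mp h)
      · right
        rw [h] at this
        apply Zsqrtd.norm_eq_one_iff.mp
        exact Nat.eq_of_mul_eq_mul_left hp.pos (by simpa using this)
  have hnd : ¬ w ∣ star w := by
    intro hd
    have h2 : w ∣ ((2 * a : ℕ) : GaussianInt) := by
      have : ((2 * a : ℕ) : GaussianInt) = w + star w := by
        ext <;> simp [w]; ring
      rw [this]; exact dvd_add dvd_rfl hd
    obtain ⟨c, hc⟩ := h2
    have h3 := congrArg Zsqrtd.norm hc
    rw [Zsqrtd.norm_mul, hw, Zsqrtd.norm_natCast] at h3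
    have h4 : p ∣ (2 * a) * (2 * a) := by
      apply Int.natCast_dvd_natCast.mp
      exact ⟨_, by push_cast at h3 ⊢; exact h3⟩
    have h5 : p ∣ 2 * a := by
      rcases hp.dvd_mul.mp h4 with h | h <;> exact h
    have h6 : p ∣ a := by
      rcases hp.dvd_mul.mp h5 with h | h
      · have := Nat.le_of_dvd (by norm_num) h
        have := hp.two_le
        interval_cases p
        omega
      · exact h
    obtain ⟨e, rfl⟩ := h6
    have hpp := hp.two_le
    rcases Nat.eq_zero_or_pos e with rfl | he
    · simp at hab
      exact (Nat.Prime.not_prime_pow (le_refl 2)) (hab ▸ hp)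
    · nlinarith [sq_nonneg b, Nat.mul_le_mul hpp he, Nat.mul_le_mul (le_refl p) he]
  have e1 := count_mul w p hp.ne_zero hw m
  have e2 := count_mul (star w) p hp.ne_zero hws m
  have e3 := count_p p hp m
  rw [← e3, two_mul]
  nth_rewrite 2 [← e2]
  rw [← e1, ← Set.ncard_union_add_ncard_inter _ _ ((finite_norm _).subset fun z hz => hz.1)
    ((finite_norm _).subset fun z hz => hz.1), f]
  congr 2
  · ext z
    simp only [Set.mem_ofPred_eq, Set.mem_union]
    constructor
    · intro h
      have hd := dvd_norm_star z p (by rw [h]; push_cast; exact dvd_mul_right _ _)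
      have : w ∣ z * star z := (Dvd.intro _ hpw.symm).trans hd
      rcases hwp.dvd_or_dvd this with h' | h'
      · exact Or.inl ⟨h, h'⟩
      · exact Or.inr ⟨h, by simpa using star_dvd h'⟩
    · rintro (h | h) <;> exact h.1
  · ext z
    simp only [Set.mem_ofPred_eq, Set.mem_inter_iff]
    constructor
    · rintro ⟨h, h'⟩
      rw [hpw] at h'
      exact ⟨⟨h, (dvd_mul_right _ _).trans h'⟩, h, (dvd_mul_left _ _).trans h'⟩
    · rintro ⟨⟨h, h'⟩, -, c, rfl⟩
      refine ⟨h, ?_⟩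
      rcases hwp.dvd_or_dvd h' with h'' | h''
      · exact absurd h'' hnd
      · obtain ⟨d, rfl⟩ := h''
        exact ⟨d, by rw [hpw]; ring⟩

lemma g_rec (p : ℕ) (hp : p.Prime) (m : ℕ) (hm : m ≠ 0) :
    g (p * m) + ZMod.χ₄ (p : ZMod 4) * (if p ∣ m then g (m / p) else 0) =
      (1 + ZMod.χ₄ (p : ZMod 4)) * g m := by
  have key : ∀ k, ∑ d ∈ (k : ℕ).divisors.image (p * ·), ZMod.χ₄ (d : ZMod 4) =
      ZMod.χ₄ (p : ZMod 4) * g k := by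
    intro k
    rw [Finset.sum_image (fun x _ y _ h => Nat.eq_of_mul_eq_mul_left hp.pos h), g, Finset.mul_sum]
    simp only [Nat.cast_mul, map_mul]
  have hu : (p * m).divisors = m.divisors ∪ m.divisors.image (p * ·) := by
    ext d
    simp only [Nat.mem_divisors, Finset.mem_union, Finset.mem_image]
    constructor
    · rintro ⟨h, h0⟩
      by_cases hpd : p ∣ d
      · obtain ⟨e, rfl⟩ := hpd
        exact Or.inr ⟨e, ⟨Nat.dvd_of_mul_dvd_mul_left hp.pos h, hm⟩, rfl⟩
      · exact Or.inl ⟨(Nat.Coprime.dvd_of_dvd_mul_left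
          ((Nat.Prime.coprime_iff_not_dvd hp).mpr hpd).symm h), hm⟩
    · rintro (h | ⟨e, h, rfl⟩)
      · exact ⟨h.1.mul_left _, mul_ne_zero hp.ne_zero hm⟩
      · exact ⟨mul_dvd_mul_left _ h.1, mul_ne_zero hp.ne_zero hm⟩
  have hi : ∑ d ∈ m.divisors ∩ m.divisors.image (p * ·), ZMod.χ₄ (d : ZMod 4) =
      ZMod.χ₄ (p : ZMod 4) * (if p ∣ m then g (m / p) else 0) := by
    split_ifs with h
    · rw [← key]
      congr 1
      obtain ⟨k, rfl⟩ := h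
      rw [Nat.mul_div_cancel_left _ hp.pos]
      ext d
      simp only [Nat.mem_divisors, Finset.mem_inter, Finset.mem_image]
      constructor
      · rintro ⟨h, e, h', rfl⟩
        exact ⟨e, ⟨Nat.dvd_of_mul_dvd_mul_left hp.pos h.1, right_ne_zero_of_mul hm⟩, rfl⟩
      · rintro ⟨e, h, rfl⟩
        exact ⟨⟨mul_dvd_mul_left _ h.1, hm⟩, e, ⟨h.1.mul_left _, hm⟩, rfl⟩
    · rw [mul_zero]
      convert Finset.sum_empty
      rw [Finset.eq_empty_iff_forall_notMem]
      intro d hd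
      simp only [Nat.mem_divisors, Finset.mem_inter, Finset.mem_image] at hd
      obtain ⟨h1, e, h2, rfl⟩ := hd
      exact h ((dvd_mul_right _ _).trans h1.1)
  rw [← hi]
  conv_lhs => rw [g, hu]
  rw [Finset.sum_union_inter, key, g]
  ring

lemma f_rec (p : ℕ) (hp : p.Prime) (m : ℕ) :
    (f (p * m) : ℤ) + ZMod.χ₄ (p : ZMod 4) * (if p ∣ m then (f (m / p) : ℤ) else 0) =
      (1 + ZMod.χ₄ (p : ZMod 4)) * f m := by
  rcases hp.eq_two_or_odd with rfl | hodd
  · have : ZMod.χ₄ ((2 : ℕ) : ZMod 4) = 0 := by decide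
    rw [this, f_two]; simp
  · have h4 : p % 4 = 1 ∨ p % 4 = 3 := by omega
    rcases h4 with h | h
    · rw [ZMod.χ₄_nat_one_mod_four h]
      have := f_one_mod p hp h m
      split_ifs at this ⊢ <;> push_cast [← this] <;> linarith
    · rw [ZMod.χ₄_nat_three_mod_four h, f_three p hp h m]
      split_ifs <;> simp

lemma f_one : f 1 = 4 := by
  have : {z : GaussianInt | z.norm = ((1 : ℕ) : ℤ)} =
      (({⟨1, 0⟩, ⟨-1, 0⟩, ⟨0, 1⟩, ⟨0, -1⟩} : Finset GaussianInt) : Set GaussianInt) := by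
    ext z
    obtain ⟨a, b⟩ := z
    simp only [Set.mem_ofPred_eq, norm_eq, Finset.coe_insert, Finset.coe_singleton,
      Set.mem_insert_iff, Set.mem_singleton_iff, Zsqrtd.mk.injEq]
    constructor
    · intro h
      push_cast at h
      have h1 : a ≤ 1 := by nlinarith [sq_nonneg b]
      have h2 : -1 ≤ a := by nlinarith [sq_nonneg b]
      have h3 : b ≤ 1 := by nlinarith [sq_nonneg a]
      have h4 : -1 ≤ b := by nlinarith [sq_nonneg a]
      interval_cases a <;> interval_cases b <;> simp_all
    · rintro (⟨rfl, rfl⟩ | ⟨rfl, rfl⟩ | ⟨rfl, rfl⟩ | ⟨rfl, rfl⟩) <;> norm_num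
  rw [f, this, Set.ncard_coe_finset]
  decide

theorem f_eq (n : ℕ) (hn : n ≠ 0) : (f n : ℤ) = 4 * g n := by
  induction n using Nat.strong_induction_on with
  | _ n ih =>
    by_cases h1 : n = 1
    · subst h1
      rw [f_one]; simp [g]
    · have hp := Nat.minFac_prime h1
      obtain ⟨m, hm⟩ := Nat.minFac_dvd n
      set p := n.minFac with hpdef
      have hm0 : m ≠ 0 := by rintro rfl; simp at hm; exact hn hm
      have hmn : m < n := by
        rw [hm]; exact (Nat.lt_mul_iff_one_lt_left (Nat.pos_of_ne_zero hm0)).mpr hp.one_lt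
      have hf := f_rec p hp m
      have hg := g_rec p hp m hm0
      rw [← hm] at hf hg
      rw [ih m hmn hm0] at hf
      split_ifs at hf hg with hd
      · have hdp : m / p ≠ 0 := (Nat.div_pos (Nat.le_of_dvd (Nat.pos_of_ne_zero hm0) hd) hp.pos).ne'
        rw [ih (m / p) ((Nat.div_le_self _ _).trans_lt hmn) hdp] at hf
        linarith
      · linarith

lemma g_two (m : ℕ) : g (2 * m) = g m := by
  rcases eq_or_ne m 0 with rfl | hm
  · simp
  have h := g_rec 2 Nat.prime_two m hm
  have : ZMod.χ₄ ((2 : ℕ) : ZMod 4) = 0 := by decide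
  rw [this] at h
  simpa using h

lemma hasSum_cosKernel_half {x : ℝ} (hx : 0 < x) :
    HasSum (fun n : ℤ => (-1 : ℝ) ^ n * Real.exp (-(n : ℝ) ^ 2 * x))
      (HurwitzZeta.cosKernel ((1 / 2 : ℝ) : UnitAddCircle) (x / π)) := by
  have h := HurwitzZeta.hasSum_int_cosKernel (1 / 2) (t := x / π) (by positivity)
  rw [← Complex.hasSum_ofReal]
  refine h.congr_fun ?_
  intro n
  have e1 : cexp (2 * π * I * ((1 / 2 : ℝ) : ℂ) * n) = (-1) ^ n := by
    rw [← Complex.exp_pi_mul_I, ← Complex.exp_int_mul]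
    congr 1; push_cast; ring
  have e2 : -π * (n : ℝ) ^ 2 * (x / π) = -(n : ℝ) ^ 2 * x := by
    field_simp
  rw [e1, e2]
  push_cast
  rfl

lemma theta4_eq {x : ℝ} (hx : 0 < x) :
    theta4 x = HurwitzZeta.cosKernel ((1 / 2 : ℝ) : UnitAddCircle) (x / π) :=
  (hasSum_cosKernel_half hx).tsum_eq

lemma hasSum_theta4 {x : ℝ} (hx : 0 < x) :
    HasSum (fun n : ℤ => (-1 : ℝ) ^ n * Real.exp (-(n : ℝ) ^ 2 * x)) (theta4 x) :=
  (hasSum_cosKernel_half hx).summable.hasSum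

lemma f_zero : f 0 = 1 := by
  have : {z : GaussianInt | z.norm = ((0 : ℕ) : ℤ)} = {0} := by
    ext z
    simp [GaussianInt.norm_eq_zero]
  rw [f, this, Set.ncard_singleton]

/-- Gaussian integers as pairs. -/
def gaussEquiv : GaussianInt ≃ ℤ × ℤ where
  toFun z := (z.re, z.im)
  invFun p := ⟨p.1, p.2⟩
  left_inv _ := rfl
  right_inv _ := rfl

lemma hasSum_theta4_sq {x : ℝ} (hx : 0 < x) :
    HasSum (fun n : ℕ => (f n : ℝ) * ((-1) ^ n * Real.exp (-(n : ℝ) * x))) (theta4 x ^ 2) := by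
  have h1 := hasSum_theta4 hx
  have h2 := h1.mul h1 (summable_mul_of_summable_norm h1.summable.norm h1.summable.norm)
  rw [← sq, ← gaussEquiv.hasSum_iff] at h2
  have h3 := h2.tsum_fiberwise (fun z : GaussianInt => z.norm.natAbs)
  refine h3.congr_fun ?_
  intro n
  have hset : (fun z : GaussianInt => z.norm.natAbs) ⁻¹' {n} =
      {z : GaussianInt | z.norm = (n : ℤ)} := by
    ext z
    simp only [Set.mem_preimage, Set.mem_singleton_iff, Set.mem_ofPred_eq]
    have := GaussianInt.norm_nonneg z
    omega
  have hval : ∀ b : (fun z : GaussianInt => z.norm.natAbs) ⁻¹' {n},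
      ((fun x_1 : ℤ × ℤ => (-1 : ℝ) ^ x_1.1 * Real.exp (-(x_1.1 : ℝ) ^ 2 * x) *
        ((-1 : ℝ) ^ x_1.2 * Real.exp (-(x_1.2 : ℝ) ^ 2 * x))) ∘ gaussEquiv) b
      = (-1) ^ n * Real.exp (-(n : ℝ) * x) := by
    rintro ⟨⟨a, b⟩, hz⟩
    rw [hset] at hz
    simp only [Set.mem_ofPred_eq, norm_eq] at hz
    simp only [Function.comp, gaussEquiv, Equiv.coe_fn_mk]
    have hc : (n : ℝ) = (a : ℝ) ^ 2 + (b : ℝ) ^ 2 := by exact_mod_cast hz.symm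
    have hp : (-1 : ℝ) ^ n = (-1) ^ a * (-1) ^ b := by
      rw [← zpow_natCast, ← hz, ← zpow_add₀ (by norm_num)]
      rcases Int.even_or_odd a with ha | ha <;> rcases Int.even_or_odd b with hb | hb
      · rw [Even.neg_one_zpow, Even.neg_one_zpow] <;> simp [ha, hb, Int.even_add, Int.even_pow]
      · rw [Odd.neg_one_zpow, Odd.neg_one_zpow] <;>
          simp [ha, hb, ← Int.not_even_iff_odd, Int.even_add, Int.even_pow] <;>
          simp [ha, Int.not_even_iff_odd, hb]
      · rw [Odd.neg_one_zpow, Odd.neg_one_zpow] <;>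
          simp [ha, hb, ← Int.not_even_iff_odd, Int.even_add, Int.even_pow] <;>
          simp [ha, Int.not_even_iff_odd, hb]
      · rw [Even.neg_one_zpow, Even.neg_one_zpow] <;>
          simp [Int.even_add, Int.even_pow, Int.not_even_iff_odd.mpr ha,
            Int.not_even_iff_odd.mpr hb]
    have he : Real.exp (-(n : ℝ) * x) =
        Real.exp (-(a : ℝ) ^ 2 * x) * Real.exp (-(b : ℝ) ^ 2 * x) := by
      rw [← Real.exp_add, hc]; congr 1; ring
    rw [hp, he]; ring
  rw [tsum_congr hval, tsum_const, nsmul_eq_mul, hset]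
  rfl

/-- the integrand kernel -/
noncomputable def F (x : ℝ) : ℂ := 1 / 4 * (1 - ((theta4 x : ℂ)) ^ 2)

lemma g_zero : g 0 = 0 := by simp [g]

lemma hasSum_F {x : ℝ} (hx : 0 < x) :
    HasSum (fun n : ℕ => (-(-1) ^ n * (g n : ℂ)) * (Real.exp (-(n : ℝ) * x) : ℂ)) (F x) := by
  have h := hasSum_ite_sub_hasSum (hasSum_theta4_sq hx) 0
  have h2 := (Complex.hasSum_ofReal.mpr h).mul_left (-1 / 4)
  have e : (-1 / 4 : ℂ) * ((theta4 x ^ 2 - (f 0 : ℝ) * ((-1) ^ 0 *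
      Real.exp (-((0 : ℕ) : ℝ) * x)) : ℝ) : ℂ) = F x := by
    rw [f_zero, F]; simp; ring
  rw [e] at h2
  refine h2.congr_fun ?_
  intro n
  by_cases hn : n = 0
  · simp [hn, g_zero]
  · have hc : ((f n : ℤ) : ℂ) = 4 * g n := by rw [f_eq n hn]; push_cast; rfl
    rw [if_neg hn]
    push_cast at hc ⊢
    rw [hc]; ring

lemma LSeries_g {s : ℂ} (hs : 1 < s.re) :
    LSeriesHasSum (fun n => (g n : ℂ)) s (riemannZeta s * dirichletBeta s) := by
  have h1 := (DirichletCharacter.LSeriesSummable_of_one_lt_re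
    (ZMod.χ₄.ringHomComp (Int.castRingHom ℂ)) hs).LSeriesHasSum
  have h2 := LSeriesHasSum_one hs
  have h3 := h1.convolution h2
  rw [← DirichletCharacter.LFunction_eq_LSeries _ hs, mul_comm] at h3
  have e : (fun n => (g n : ℂ)) = LSeries.convolution
      (fun n : ℕ => (ZMod.χ₄.ringHomComp (Int.castRingHom ℂ)) (n : ZMod 4)) 1 := by
    rw [LSeries.convolution_def]
    ext n
    rw [Nat.sum_divisorsAntidiagonal (fun a b =>
      (ZMod.χ₄.ringHomComp (Int.castRingHom ℂ)) (a : ZMod 4) * (1 : ℕ → ℂ) b), g]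
    push_cast
    simp only [Pi.one_apply, mul_one]
    rfl
  rw [e]
  exact h3

lemma mellin_F {s : ℂ} (hs : 1 < s.re) :
    mellin F s = (1 - (2 : ℂ) ^ (1 - s)) * Complex.Gamma s * riemannZeta s * dirichletBeta s := by
  have hL := LSeries_g hs
  set A := riemannZeta s * dirichletBeta s with hA
  have hL' : HasSum (LSeries.term (fun n => (g n : ℂ)) s) A := hL
  have hm := hasSum_mellin (a := fun n : ℕ => (-(-1) ^ n * (g n : ℂ))) (p := fun n : ℕ => (n : ℝ))
    (F := F) (s := s) (fun n => by
      rcases Nat.eq_zero_or_pos n with rfl | h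
      · left; simp [g_zero]
      · right; exact_mod_cast h) (by linarith) (fun t ht => by
        simpa using hasSum_F (x := t) ht) (by
        refine hL'.summable.norm.congr ?_
        intro n
        rw [LSeries.norm_term_eq]
        split_ifs with h
        · simp [h, g_zero]
        · simp)
  have heven : HasSum (fun n : ℕ => if Even n then LSeries.term (fun n => (g n : ℂ)) s n else 0)
      ((2 : ℂ) ^ (-s) * A) := by
    have hinj : Function.Injective (fun n : ℕ => 2 * n) := fun a b h => by simpa using h
    rw [← hinj.hasSum_iff]
    · refine (hL'.mul_left _).congr_fun ?_
      intro n
      simp only [Function.comp, even_two, Even.mul_right, if_true]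
      rcases eq_or_ne n 0 with rfl | hn
      · simp
      rw [LSeries.term_of_ne_zero (by simpa using hn), LSeries.term_of_ne_zero hn, g_two]
      have hc := Complex.natCast_mul_natCast_cpow 2 n s
      push_cast at hc ⊢
      rw [hc, Complex.cpow_neg]
      field_simp
    · intro n hn
      rw [if_neg]
      rintro ⟨k, rfl⟩
      exact hn ⟨k, by simp; ring⟩
  have h3 := (hL'.sub (heven.mul_left 2)).mul_left (Complex.Gamma s)
  have h4 : HasSum (fun i : ℕ => Complex.Gamma s * (-(-1) ^ i * (g i : ℂ)) / ((i : ℝ) : ℂ) ^ s)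
      (Complex.Gamma s * (A - 2 * ((2 : ℂ) ^ (-s) * A))) := by
    refine h3.congr_fun ?_
    intro n
    rcases eq_or_ne n 0 with rfl | hn
    · simp [g_zero]
    rw [LSeries.term_of_ne_zero hn]
    rcases Nat.even_or_odd n with he | ho
    · rw [if_pos he, he.neg_one_pow]; push_cast; ring
    · rw [if_neg (Nat.not_even_iff_odd.mpr ho), ho.neg_one_pow]; push_cast; ring
  rw [hm.unique h4, hA, sub_eq_add_neg 1 s, Complex.cpow_add _ _ two_ne_zero, Complex.cpow_one]
  ring

lemma F_cont : ContinuousOn F (Set.Ioi 0) := by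
  have h : ContinuousOn (fun x : ℝ =>
      HurwitzZeta.cosKernel ((1 / 2 : ℝ) : UnitAddCircle) (x / π)) (Set.Ioi 0) :=
    (HurwitzZeta.continuousOn_cosKernel _).comp (by fun_prop)
      (fun x (hx : 0 < x) => div_pos hx Real.pi_pos)
  have h2 : ContinuousOn theta4 (Set.Ioi 0) := h.congr fun x hx => theta4_eq hx
  unfold F
  have h3 : ContinuousOn (fun x => (theta4 x : ℂ)) (Set.Ioi 0) :=
    Complex.continuous_ofReal.comp_continuousOn h2
  fun_prop

open Filter Asymptotics Topology

lemma theta4_top : ∃ p, 0 < p ∧ (fun x => theta4 x - 1) =O[atTop] (fun x => Real.exp (-p * x)) := by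
  obtain ⟨p, hp, h⟩ := HurwitzZeta.isBigO_atTop_cosKernel_sub ((1 / 2 : ℝ) : UnitAddCircle)
  refine ⟨p / π, by positivity, ?_⟩
  have h2 := h.comp_tendsto (tendsto_id.atTop_div_const Real.pi_pos)
  refine (h2.congr' ?_ ?_)
  · filter_upwards [eventually_gt_atTop 0] with x hx
    simp [theta4_eq hx]
  · filter_upwards with x
    simp only [Function.comp, id]; congr 1; ring

lemma F_top : ∃ p, 0 < p ∧ F =O[atTop] (fun x => Real.exp (-p * x)) := by
  obtain ⟨p, hp, h⟩ := theta4_top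
  refine ⟨p, hp, ?_⟩
  have h0 : Tendsto (fun x => Real.exp (-p * x)) atTop (𝓝 0) := by
    have : Tendsto (fun x => p * x) atTop atTop := tendsto_id.const_mul_atTop hp
    simpa [Function.comp_def] using Real.tendsto_exp_neg_atTop_nhds_zero.comp this
  have h1 : (fun x => theta4 x + 1) =O[atTop] (fun _ => (1 : ℝ)) := by
    have := (h.trans_tendsto h0).add_const 2
    have h5 : Tendsto (fun x => theta4 x + 1) atTop (𝓝 (0 + 2)) :=
      this.congr fun x => by ring
    exact h5.isBigO_one ℝ
  have h2 := (h.mul h1).const_mul_left (-1 / 4)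
  rw [← isBigO_norm_left]
  refine (h2.norm_left.congr' ?_ ?_)
  · filter_upwards with x
    rw [← Complex.norm_real, F]
    congr 1; push_cast; ring
  · filter_upwards with x; simp

lemma theta4_bot : theta4 =O[𝓝[>] 0] (fun _ => (1 : ℝ)) := by
  have hne : ((1 / 2 : ℝ) : UnitAddCircle) ≠ 0 := by
    intro h
    rw [AddCircle.coe_eq_zero_iff] at h
    obtain ⟨n, hn⟩ := h
    simp at hn
    have : ((2 * n : ℤ) : ℝ) = 1 := by push_cast; rw [hn]; norm_num
    have h2 : 2 * n = 1 := by exact_mod_cast this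
    omega
  obtain ⟨p, hp, h⟩ := HurwitzZeta.isBigO_atTop_evenKernel_sub ((1 / 2 : ℝ) : UnitAddCircle)
  simp only [if_neg hne, sub_zero] at h
  have h1 : (fun y : ℝ => y ^ (1 / 2 : ℝ) * HurwitzZeta.evenKernel ((1 / 2 : ℝ) : UnitAddCircle) y)
      =O[atTop] (fun _ => (1 : ℝ)) := by
    have h2 := (isBigO_refl (fun y : ℝ => y ^ (1 / 2 : ℝ)) atTop).mul
      (h.trans (isLittleO_exp_neg_mul_rpow_atTop hp (-(1 / 2))).isBigO)
    refine h2.congr' EventuallyEq.rfl ?_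
    filter_upwards [eventually_gt_atTop 0] with y hy
    rw [← Real.rpow_add hy]; simp
  have ht : Tendsto (fun x : ℝ => π * x⁻¹) (𝓝[>] 0) atTop :=
    tendsto_inv_nhdsGT_zero.const_mul_atTop Real.pi_pos
  refine (h1.comp_tendsto ht).congr' ?_ EventuallyEq.rfl
  filter_upwards [self_mem_nhdsWithin] with x hx
  have hx : 0 < x := hx
  simp only [Function.comp]
  have hy : 0 < π * x⁻¹ := by positivity
  rw [HurwitzZeta.evenKernel_functional_equation, theta4_eq hx]
  have e : 1 / (π * x⁻¹) = x / π := by field_simp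
  rw [e]
  have := (Real.rpow_pos_of_pos hy (1/2)).ne'
  field_simp

lemma F_bot : F =O[𝓝[>] 0] (fun x : ℝ => x ^ (-(0 : ℝ))) := by
  have h := theta4_bot.mul theta4_bot
  have h1 := ((isBigO_refl (fun _ : ℝ => (1 : ℝ)) (𝓝[>] 0)).sub
    (h.congr_right fun _ => mul_one 1)).const_mul_left (1 / 4)
  rw [← isBigO_norm_left]
  refine h1.norm_left.congr' ?_ ?_
  · filter_upwards with x
    rw [← Complex.norm_real, F]
    congr 1; push_cast; ring
  · filter_upwards with x; simp

lemma mellin_diff {s : ℂ} (hs : 0 < s.re) : DifferentiableAt ℂ (mellin F) s := by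
  obtain ⟨p, hp, h⟩ := F_top
  exact mellin_differentiableAt_of_isBigO_rpow_exp hp
    (F_cont.locallyIntegrableOn measurableSet_Ioi) h F_bot hs

lemma chi_ne : (ZMod.χ₄.ringHomComp (Int.castRingHom ℂ)) ≠ 1 := by
  intro h
  have h1 := congrArg (fun χ : MulChar (ZMod 4) ℂ => χ 3) h
  have h3 : ZMod.χ₄ 3 = -1 := by decide
  have h4 : IsUnit (3 : ZMod 4) := by decide
  simp only [MulChar.ringHomComp_apply, h3] at h1
  rw [MulChar.one_apply h4] at h1
  norm_num at h1

lemma U_preconn : IsPreconnected {s : ℂ | 0 < s.re ∧ s ≠ 1} := by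
  have c1 : Convex ℝ ({s : ℂ | 0 < s.re} ∩ {s : ℂ | 0 < s.im}) :=
    (convex_halfSpace_re_gt 0).inter (convex_halfSpace_im_gt 0)
  have c2 : Convex ℝ {s : ℂ | 1 < s.re} := convex_halfSpace_re_gt 1
  have c3 : Convex ℝ ({s : ℂ | 0 < s.re} ∩ {s : ℂ | s.im < 0}) :=
    (convex_halfSpace_re_gt 0).inter (convex_halfSpace_im_lt 0)
  have c4 : Convex ℝ ({s : ℂ | 0 < s.re} ∩ {s : ℂ | s.re < 1}) :=
    (convex_halfSpace_re_gt 0).inter (convex_halfSpace_re_lt 1)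
  have u1 := IsPreconnected.union (⟨2, 1⟩ : ℂ) (by simp) (by simp)
    c1.isPreconnected c2.isPreconnected
  have u2 := IsPreconnected.union (⟨2, -1⟩ : ℂ) (by simp) (by simp)
    u1 c3.isPreconnected
  have u3 := IsPreconnected.union (⟨1 / 2, 1⟩ : ℂ) (by simp) (by norm_num)
    u2 c4.isPreconnected
  convert u3 using 1
  ext s
  simp only [Set.mem_ofPred_eq, Set.mem_union, Set.mem_inter_iff, ne_eq, Complex.ext_iff,
    Complex.one_re, Complex.one_im]
  constructor
  · rintro ⟨h, h'⟩
    rcases lt_trichotomy s.im 0 with h1 | h1 | h1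
    · exact Or.inl (Or.inr ⟨h, h1⟩)
    · rcases lt_trichotomy s.re 1 with h2 | h2 | h2
      · exact Or.inr ⟨h, h2⟩
      · exact absurd ⟨h2, h1⟩ h'
      · exact Or.inl (Or.inl (Or.inr h2))
    · exact Or.inl (Or.inl (Or.inl ⟨h, h1⟩))
  · rintro (((h | h) | h) | h)
    · exact ⟨h.1, fun h' => h.2.ne' h'.2⟩
    · exact ⟨by linarith, fun h' => h.ne' h'.1⟩
    · exact ⟨h.1, fun h' => h.2.ne h'.2⟩
    · exact ⟨h.1, fun h' => h.2.ne h'.1⟩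

theorem mellin_F_full {s : ℂ} (hs : 0 < s.re) (hs1 : s ≠ 1) :
    mellin F s = (1 - (2 : ℂ) ^ (1 - s)) * Complex.Gamma s * riemannZeta s * dirichletBeta s := by
  have hU : IsOpen {s : ℂ | 0 < s.re ∧ s ≠ 1} :=
    (isOpen_lt continuous_const Complex.continuous_re).inter isOpen_ne
  have hf : AnalyticOnNhd ℂ (mellin F) {s : ℂ | 0 < s.re ∧ s ≠ 1} :=
    DifferentiableOn.analyticOnNhd (fun z hz => (mellin_diff hz.1).differentiableWithinAt) hU
  have hg : AnalyticOnNhd ℂ (fun s => (1 - (2 : ℂ) ^ (1 - s)) * Complex.Gamma s *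
      riemannZeta s * dirichletBeta s) {s : ℂ | 0 < s.re ∧ s ≠ 1} := by
    refine DifferentiableOn.analyticOnNhd (fun z hz => DifferentiableAt.differentiableWithinAt ?_) hU
    have d1 : DifferentiableAt ℂ (fun s => 1 - (2 : ℂ) ^ (1 - s)) z := by
      refine (differentiableAt_const _).sub (DifferentiableAt.const_cpow (by fun_prop) (Or.inl two_ne_zero))
    have d2 : DifferentiableAt ℂ Complex.Gamma z := by
      refine Complex.differentiableAt_Gamma z fun m hm => ?_
      have h0 := hz.1
      rw [hm] at h0
      simp at h0
      have : (0 : ℝ) ≤ m := Nat.cast_nonneg m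
      linarith
    have d3 : DifferentiableAt ℂ riemannZeta z := differentiableAt_riemannZeta hz.2
    have d4 : DifferentiableAt ℂ dirichletBeta z :=
      DirichletCharacter.differentiable_LFunction chi_ne z
    exact ((d1.mul d2).mul d3).mul d4
  have h2 : (2 : ℂ) ∈ {s : ℂ | 0 < s.re ∧ s ≠ 1} := by constructor <;> norm_num
  refine hf.eqOn_of_preconnected_of_eventuallyEq hg U_preconn h2 ?_ ⟨hs, hs1⟩
  have : {s : ℂ | 1 < s.re} ∈ 𝓝 (2 : ℂ) :=
    (isOpen_lt continuous_const Complex.continuous_re).mem_nhds (by simp)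
  filter_upwards [this] with z hz
  exact mellin_F hz

end TwoSq

/-- For `Re(s) > 0`, `s ≠ 1`:
`∫_0^∞ x^{s-1} ¼(1 - θ₄²(0|ix/π)) dx = (1 - 2^{1-s}) Γ(s) ζ(s) L(s)`;
equivalently, when `2^{1-s} ≠ 1`,
`Γ(s) π^{-s} ζ(s) L(s) = (π^{-s}/(1 - 2^{1-s})) ∫_0^∞ x^{s-1} ¼(1 - θ₄²(0|ix/π)) dx`. -/
theorem A_first_integral (s : ℂ) (hs : 0 < s.re) (hs1 : s ≠ 1) :
    (∫ x in Set.Ioi (0 : ℝ), (x : ℂ) ^ (s - 1) * (1 / 4 * (1 - ((theta4 x : ℂ)) ^ 2)) =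
      (1 - (2 : ℂ) ^ (1 - s)) * Complex.Gamma s * riemannZeta s * dirichletBeta s) ∧
    ((2 : ℂ) ^ (1 - s) ≠ 1 →
      Complex.Gamma s * (π : ℂ) ^ (-s) * riemannZeta s * dirichletBeta s =
        (π : ℂ) ^ (-s) / (1 - (2 : ℂ) ^ (1 - s)) *
          ∫ x in Set.Ioi (0 : ℝ), (x : ℂ) ^ (s - 1) *
            (1 / 4 * (1 - ((theta4 x : ℂ)) ^ 2))) := by
  have key : ∫ x in Set.Ioi (0 : ℝ), (x : ℂ) ^ (s - 1) * (1 / 4 * (1 - ((theta4 x : ℂ)) ^ 2)) =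
      (1 - (2 : ℂ) ^ (1 - s)) * Complex.Gamma s * riemannZeta s * dirichletBeta s :=
    TwoSq.mellin_F_full hs hs1
  refine ⟨key, fun h => ?_⟩
  rw [key]
  have h' : 1 - (2 : ℂ) ^ (1 - s) ≠ 0 := sub_ne_zero.mpr h.symm
  field_simp
end

section
/- For every complex number s with Re(s) > 1, the Epstein zeta series Σ_{(m,n)∈ℤ², (m,n)≠(0,0)} (m² + n²)^{-s} converges and equals 4 ζ(s) L(s). -/
open Complex

/-- Integer points on the circle of squared radius `n`. -/
def circPts (n : ℕ) : Set (ℤ × ℤ) := {z | z.1 ^ 2 + z.2 ^ 2 = (n : ℤ)}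

lemma circPts_finite (n : ℕ) : (circPts n).Finite := by
  refine ((Set.finite_Icc (-(n : ℤ)) n).prod (Set.finite_Icc (-(n : ℤ)) n)).subset ?_
  rintro ⟨x, y⟩ h
  have h : x ^ 2 + y ^ 2 = (n : ℤ) := h
  simp only [Set.mem_prod, Set.mem_Icc]
  have hx : x ≤ x ^ 2 := Int.le_self_sq x
  have hx' : -x ≤ x ^ 2 := by have := Int.le_self_sq (-x); simpa using this
  have hy : y ≤ y ^ 2 := Int.le_self_sq y
  have hy' : -y ≤ y ^ 2 := by have := Int.le_self_sq (-y); simpa using this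
  have := sq_nonneg x
  have := sq_nonneg y
  refine ⟨⟨?_, ?_⟩, ?_, ?_⟩ <;> linarith

/-- Multiplication by the Gaussian integer `a + b i`. -/
def gmul (a b : ℤ) (z : ℤ × ℤ) : ℤ × ℤ := (a * z.1 - b * z.2, a * z.2 + b * z.1)

lemma gmul_inj (a b : ℤ) (h : a ^ 2 + b ^ 2 ≠ 0) : Function.Injective (gmul a b) := by
  rintro ⟨x, y⟩ ⟨u, v⟩ hz
  simp only [gmul, Prod.mk.injEq] at hz
  obtain ⟨h1, h2⟩ := hz
  have e1 : (a ^ 2 + b ^ 2) * x = (a ^ 2 + b ^ 2) * u := by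
    linear_combination a * h1 + b * h2
  have e2 : (a ^ 2 + b ^ 2) * y = (a ^ 2 + b ^ 2) * v := by
    linear_combination a * h2 - b * h1
  exact Prod.ext (mul_left_cancel₀ h e1) (mul_left_cancel₀ h e2)

lemma mem_gmul_image {p n : ℕ} (hp : p ≠ 0) {a b x y : ℤ} (hab : a ^ 2 + b ^ 2 = p) :
    (x, y) ∈ gmul a b '' circPts n ↔
      x ^ 2 + y ^ 2 = p * n ∧ (p : ℤ) ∣ a * x + b * y ∧ (p : ℤ) ∣ a * y - b * x := by
  have hp' : (p : ℤ) ≠ 0 := by exact_mod_cast hp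
  constructor
  · rintro ⟨⟨u, v⟩, h, hz⟩
    have h : u ^ 2 + v ^ 2 = (n : ℤ) := h
    simp only [gmul, Prod.mk.injEq] at hz
    obtain ⟨rfl, rfl⟩ := hz
    refine ⟨?_, ⟨u, ?_⟩, ⟨v, ?_⟩⟩
    · rw [← hab, ← h]; ring
    · rw [← hab]; ring
    · rw [← hab]; ring
  · rintro ⟨h, ⟨u, hu⟩, ⟨v, hv⟩⟩
    have e1 : a * u - b * v = x := by
      apply mul_left_cancel₀ hp'
      linear_combination (-a) * hu + b * hv + x * hab
    have e2 : a * v + b * u = y := by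
      apply mul_left_cancel₀ hp'
      linear_combination (-a) * hv - b * hu + y * hab
    refine ⟨(u, v), ?_, ?_⟩
    · show u ^ 2 + v ^ 2 = (n : ℤ)
      apply mul_left_cancel₀ hp'
      rw [← h, ← e1, ← e2]
      linear_combination (-u ^ 2 - v ^ 2) * hab
    · simp [gmul, e1, e2]

/-- Points both of whose coordinates are divisible by `p`. -/
lemma ncard_dvd_pts {p : ℕ} (hp : p ≠ 0) (n : ℕ) :
    {z : ℤ × ℤ | z.1 ^ 2 + z.2 ^ 2 = p * n ∧ (p : ℤ) ∣ z.1 ∧ (p : ℤ) ∣ z.2}.ncard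
      = if p ∣ n then (circPts (n / p)).ncard else 0 := by
  have hp' : (p : ℤ) ≠ 0 := by exact_mod_cast hp
  split_ifs with hd
  · obtain ⟨k, rfl⟩ := hd
    rw [Nat.mul_div_cancel_left k (Nat.pos_of_ne_zero hp)]
    rw [← Set.ncard_image_of_injective (circPts k) (gmul_inj p 0 (by simpa using hp))]
    congr 1
    ext ⟨x, y⟩
    constructor
    · rintro ⟨h, ⟨u, hu⟩, ⟨v, hv⟩⟩
      simp only at hu hv h
      subst hu hv
      refine ⟨(u, v), ?_, by simp [gmul]⟩
      show u ^ 2 + v ^ 2 = (k : ℤ)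
      apply mul_left_cancel₀ (mul_ne_zero hp' hp')
      push_cast at h
      linear_combination h
    · rintro ⟨⟨u, v⟩, h, hz⟩
      have h : u ^ 2 + v ^ 2 = (k : ℤ) := h
      simp only [gmul, Prod.mk.injEq] at hz
      obtain ⟨rfl, rfl⟩ := hz
      refine ⟨?_, ⟨u, by ring⟩, ⟨v, by ring⟩⟩
      push_cast
      rw [← h]; ring
  · rw [Set.ncard_eq_zero ((circPts_finite (p * n)).subset (by
      rintro z ⟨h, -⟩; show z.1 ^ 2 + z.2 ^ 2 = ((p * n : ℕ) : ℤ); exact_mod_cast h))]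
    ext ⟨x, y⟩
    simp only [Set.mem_setOf_eq, Set.mem_empty_iff_false, iff_false]
    rintro ⟨h, ⟨u, rfl⟩, ⟨v, rfl⟩⟩
    apply hd
    have : (p : ℤ) ∣ n := by
      refine ⟨u ^ 2 + v ^ 2, ?_⟩
      apply mul_left_cancel₀ hp'
      linear_combination -h
    exact_mod_cast this

lemma mem_circPts_mul {p n : ℕ} {z : ℤ × ℤ} :
    z ∈ circPts (p * n) ↔ z.1 ^ 2 + z.2 ^ 2 = (p : ℤ) * n := by
  simp [circPts]

lemma r_rec_two (n : ℕ) : (circPts (2 * n)).ncard = (circPts n).ncard := by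
  rw [← Set.ncard_image_of_injective (circPts n) (gmul_inj 1 1 (by norm_num))]
  congr 1
  ext ⟨x, y⟩
  rw [mem_gmul_image (p := 2) two_ne_zero (by norm_num), mem_circPts_mul]
  refine ⟨fun h => ⟨h, ?_⟩, fun h => h.1⟩
  simp only at h
  have e : Even (x ^ 2 + y ^ 2) := ⟨n, by rw [h]; push_cast; ring⟩
  have e' : Even x ↔ Even y := by
    simpa [Int.even_add, Int.even_pow] using e
  push_cast
  constructor
  · rw [← even_iff_two_dvd]; simp [Int.even_add, e']
  · rw [← even_iff_two_dvd]; simp [Int.even_sub, e']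

lemma r_rec_three {p : ℕ} (hp : p.Prime) (h3 : p % 4 = 3) (n : ℕ) :
    (circPts (p * n)).ncard = if p ∣ n then (circPts (n / p)).ncard else 0 := by
  haveI := Fact.mk hp
  rw [← ncard_dvd_pts hp.ne_zero]
  congr 1
  ext ⟨x, y⟩
  rw [mem_circPts_mul]
  refine ⟨fun h => ⟨h, ?_⟩, fun h => h.1⟩
  simp only at h ⊢
  have h0 : (x : ZMod p) ^ 2 + (y : ZMod p) ^ 2 = 0 := by
    have := congrArg (Int.cast : ℤ → ZMod p) h
    push_cast at this
    simpa using this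
  simp only [← ZMod.intCast_zmod_eq_zero_iff_dvd]
  constructor
  · by_contra hx
    exact ZMod.mod_four_ne_three_of_sq_eq_neg_sq hx (eq_neg_of_add_eq_zero_left h0) h3
  · by_contra hx
    exact ZMod.mod_four_ne_three_of_sq_eq_neg_sq' hx (eq_neg_of_add_eq_zero_left h0) h3

lemma r_rec_one {p : ℕ} (hp : p.Prime) (h1 : p % 4 = 1) (n : ℕ) :
    (circPts (p * n)).ncard + (if p ∣ n then (circPts (n / p)).ncard else 0)
      = 2 * (circPts n).ncard := by
  haveI := Fact.mk hp
  obtain ⟨a', b', hab'⟩ := Nat.Prime.sq_add_sq (p := p) (by omega)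
  obtain ⟨a, rfl⟩ : ∃ a : ℤ, a = a' := ⟨_, rfl⟩
  generalize ha : (a' : ℤ) = a
  generalize hb : (b' : ℤ) = b
  have hab : a ^ 2 + b ^ 2 = p := by rw [← ha, ← hb]; exact_mod_cast hab'
  have hab2 : a ^ 2 + (-b) ^ 2 = p := by rw [← hab]; ring
  have hpz : Prime (p : ℤ) := Nat.prime_iff_prime_int.mp hp
  have hp0 : (p : ℤ) ≠ 0 := hpz.ne_zero
  have hpa : ¬ (p : ℤ) ∣ a := by
    intro hd
    have hd2 : (p : ℤ) ∣ b := by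
      apply hpz.dvd_of_dvd_pow (n := 2)
      have : b ^ 2 = p - a ^ 2 := by linarith
      rw [this]
      exact dvd_sub dvd_rfl (dvd_pow hd two_ne_zero)
    obtain ⟨u, rfl⟩ := hd
    obtain ⟨v, rfl⟩ := hd2
    have : (p : ℤ) * (u ^ 2 + v ^ 2) = 1 := by
      apply mul_left_cancel₀ hp0
      linear_combination hab
    exact hpz.not_unit (IsUnit.of_mul_eq_one _ this)
  have hpb : ¬ (p : ℤ) ∣ b := by
    intro hd
    apply hpa
    apply hpz.dvd_of_dvd_pow (n := 2)
    have : a ^ 2 = p - b ^ 2 := by linarith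
    rw [this]
    exact dvd_sub dvd_rfl (dvd_pow hd two_ne_zero)
  have hp2 : ¬ (p : ℤ) ∣ 2 := by
    intro hd
    have : p ∣ 2 := by exact_mod_cast hd
    have := Nat.le_of_dvd (by norm_num) this
    have := hp.two_le
    omega
  have key : ∀ x y c : ℤ, a ^ 2 + c ^ 2 = p → x ^ 2 + y ^ 2 = p * n → (p : ℤ) ∣ a * x + c * y →
      (p : ℤ) ∣ a * y - c * x := by
    intro x y c hc h hd
    apply hpz.dvd_of_dvd_pow (n := 2)
    have : (a * y - c * x) ^ 2 = p * (p * n) - (a * x + c * y) ^ 2 := by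
      rw [← h]
      nth_rewrite 1 [← hc]
      ring
    rw [this]
    exact dvd_sub (dvd_mul_right _ _) (dvd_pow hd two_ne_zero)
  have hU : circPts (p * n) = gmul a b '' circPts n ∪ gmul a (-b) '' circPts n := by
    ext ⟨x, y⟩
    rw [Set.mem_union, mem_gmul_image hp.ne_zero hab, mem_gmul_image hp.ne_zero hab2,
      mem_circPts_mul]
    refine ⟨fun h => ?_, fun h => h.elim And.left And.left⟩
    simp only at h
    have hd : (p : ℤ) ∣ (a * x + b * y) * (a * x + (-b) * y) := by
      refine ⟨a ^ 2 * n - y ^ 2, ?_⟩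
      linear_combination a ^ 2 * h - y ^ 2 * hab
    rcases hpz.dvd_or_dvd hd with hd | hd
    · exact Or.inl ⟨h, hd, key _ _ _ hab h hd⟩
    · exact Or.inr ⟨h, hd, key _ _ _ hab2 h hd⟩
  have hI : gmul a b '' circPts n ∩ gmul a (-b) '' circPts n =
      {z : ℤ × ℤ | z.1 ^ 2 + z.2 ^ 2 = p * n ∧ (p : ℤ) ∣ z.1 ∧ (p : ℤ) ∣ z.2} := by
    ext ⟨x, y⟩
    rw [Set.mem_inter_iff, mem_gmul_image hp.ne_zero hab, mem_gmul_image hp.ne_zero hab2]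
    constructor
    · rintro ⟨⟨h, h1, -⟩, -, h2, -⟩
      refine ⟨h, ?_, ?_⟩
      · have : (p : ℤ) ∣ 2 * (a * x) := by
          have := dvd_add h1 h2
          ring_nf at this ⊢
          exact this
        exact ((hpz.dvd_or_dvd ((hpz.dvd_or_dvd this).resolve_left hp2)).resolve_left hpa)
      · have : (p : ℤ) ∣ 2 * (b * y) := by
          have := dvd_sub h1 h2
          ring_nf at this ⊢
          exact this
        exact ((hpz.dvd_or_dvd ((hpz.dvd_or_dvd this).resolve_left hp2)).resolve_left hpb)
    · rintro ⟨h, hx, hy⟩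
      simp only at h hx hy
      exact ⟨⟨h, dvd_add (hx.mul_left _) (hy.mul_left _), dvd_sub (hy.mul_left _) (hx.mul_left _)⟩,
        h, dvd_add (hx.mul_left _) (hy.mul_left _), dvd_sub (hy.mul_left _) (hx.mul_left _)⟩
  rw [← ncard_dvd_pts hp.ne_zero, ← hI, hU, Set.ncard_union_add_ncard_inter _ _
    ((circPts_finite n).image _) ((circPts_finite n).image _),
    Set.ncard_image_of_injective _ (gmul_inj a b (by rw [hab]; exact hp0)),
    Set.ncard_image_of_injective _ (gmul_inj a (-b) (by rw [hab2]; exact hp0))]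
  ring

lemma r_rec {p : ℕ} (hp : p.Prime) (n : ℕ) :
    ((circPts (p * n)).ncard : ℤ) = (1 + ZMod.χ₄ p) * (circPts n).ncard
      - ZMod.χ₄ p * (if p ∣ n then ((circPts (n / p)).ncard : ℤ) else 0) := by
  rw [ZMod.χ₄_nat_eq_if_mod_four]
  rcases hp.eq_two_or_odd with rfl | h2
  · simp [r_rec_two]
  · rcases (by omega : p % 4 = 1 ∨ p % 4 = 3) with h | h
    · have := r_rec_one hp h n
      simp only [h2, h]
      split_ifs at this ⊢ <;> first | contradiction | omega | (push_cast; linarith)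
    · rw [r_rec_three hp h]
      simp only [h2, h]
      split_ifs <;> first | contradiction | omega | simp

/-- The divisor sum of the character. -/
def chiSum (n : ℕ) : ℤ := ∑ d ∈ n.divisors, ZMod.χ₄ (d : ZMod 4)

lemma chiSum_rec {p : ℕ} (hp : p.Prime) {n : ℕ} (hn : n ≠ 0) :
    chiSum (p * n) = (1 + ZMod.χ₄ p) * chiSum n
      - ZMod.χ₄ p * (if p ∣ n then chiSum (n / p) else 0) := by
  have hinj : Function.Injective (fun d : ℕ => p * d) := fun a b h =>
    Nat.eq_of_mul_eq_mul_left hp.pos h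
  have hmul : ∀ m : ℕ, ∑ d ∈ m.divisors.image (fun d => p * d), ZMod.χ₄ (d : ZMod 4)
      = ZMod.χ₄ p * chiSum m := by
    intro m
    rw [Finset.sum_image (fun a _ b _ h => hinj h), chiSum, Finset.mul_sum]
    exact Finset.sum_congr rfl fun d _ => by push_cast; rw [map_mul]
  have hU : (p * n).divisors = n.divisors ∪ n.divisors.image (fun d => p * d) := by
    ext d
    simp only [Nat.mem_divisors, Finset.mem_union, Finset.mem_image]
    constructor
    · rintro ⟨hd, h0⟩
      by_cases hpd : p ∣ d
      · obtain ⟨e, rfl⟩ := hpd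
        exact Or.inr ⟨e, ⟨Nat.dvd_of_mul_dvd_mul_left hp.pos hd, hn⟩, rfl⟩
      · exact Or.inl ⟨((Nat.Prime.coprime_iff_not_dvd hp).mpr hpd).symm.dvd_of_dvd_mul_left hd, hn⟩
    · rintro (⟨hd, -⟩ | ⟨e, ⟨he, -⟩, rfl⟩)
      · exact ⟨hd.mul_left _, mul_ne_zero hp.ne_zero hn⟩
      · exact ⟨mul_dvd_mul_left _ he, mul_ne_zero hp.ne_zero hn⟩
  have hI : ∑ d ∈ n.divisors ∩ n.divisors.image (fun d => p * d), ZMod.χ₄ (d : ZMod 4)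
      = ZMod.χ₄ p * (if p ∣ n then chiSum (n / p) else 0) := by
    split_ifs with h
    · rw [← hmul]
      congr 1
      ext d
      simp only [Nat.mem_divisors, Finset.mem_inter, Finset.mem_image]
      obtain ⟨k, rfl⟩ := h
      rw [Nat.mul_div_cancel_left k hp.pos]
      constructor
      · rintro ⟨⟨hd, -⟩, e, -, rfl⟩
        exact ⟨e, ⟨Nat.dvd_of_mul_dvd_mul_left hp.pos hd, right_ne_zero_of_mul hn⟩, rfl⟩
      · rintro ⟨e, ⟨he, -⟩, rfl⟩
        exact ⟨⟨mul_dvd_mul_left _ he, hn⟩, e, ⟨he.mul_left _, hn⟩, rfl⟩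
    · rw [mul_zero]
      apply Finset.sum_eq_zero
      intro d hd
      exfalso
      simp only [Nat.mem_divisors, Finset.mem_inter, Finset.mem_image] at hd
      obtain ⟨⟨hd, -⟩, e, -, rfl⟩ := hd
      exact h ((dvd_mul_right _ _).trans hd)
  have := Finset.sum_union_inter (s₁ := n.divisors) (s₂ := n.divisors.image (fun d => p * d))
    (f := fun d : ℕ => ZMod.χ₄ (d : ZMod 4))
  rw [hI, hmul, ← hU] at this
  change chiSum (p * n) + _ = chiSum n + _ at this
  linarith

/-- Jacobi's two-square theorem. -/
lemma jacobi_two_sq (n : ℕ) (hn : n ≠ 0) : ((circPts n).ncard : ℤ) = 4 * chiSum n := by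
  induction n using Nat.strong_induction_on with
  | _ n ih =>
    by_cases h1 : n = 1
    · subst h1
      have : circPts 1 = (({(1, 0), (-1, 0), (0, 1), (0, -1)} : Finset (ℤ × ℤ)) : Set (ℤ × ℤ)) := by
        ext ⟨x, y⟩
        simp only [circPts, Set.mem_setOf_eq, Finset.coe_insert, Finset.coe_singleton,
          Set.mem_insert_iff, Set.mem_singleton_iff, Prod.mk.injEq]
        constructor
        · intro h
          push_cast at h
          have hx : x ≤ 1 := by nlinarith [sq_nonneg y]
          have hx' : -1 ≤ x := by nlinarith [sq_nonneg y]
          have hy : y ≤ 1 := by nlinarith [sq_nonneg x]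
          have hy' : -1 ≤ y := by nlinarith [sq_nonneg x]
          interval_cases x <;> interval_cases y <;> simp_all
        · rintro (⟨rfl, rfl⟩ | ⟨rfl, rfl⟩ | ⟨rfl, rfl⟩ | ⟨rfl, rfl⟩) <;> norm_num
      rw [this, Set.ncard_coe_finset]
      simp [chiSum]
    · obtain ⟨p, hp, m, rfl⟩ := Nat.exists_prime_and_dvd h1
      have hm : m ≠ 0 := right_ne_zero_of_mul hn
      have hlt : m < p * m := by
        have := hp.two_le
        have := Nat.pos_of_ne_zero hm
        nlinarith
      rw [r_rec hp, chiSum_rec hp hm, ih m hlt hm]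
      split_ifs with hd
      · have hk : m / p ≠ 0 := (Nat.div_pos (Nat.le_of_dvd (Nat.pos_of_ne_zero hm) hd) hp.pos).ne'
        rw [ih (m / p) (lt_of_le_of_lt (Nat.div_le_self _ _) hlt) hk]
        ring
      · ring

/-- Squared radius as a natural number. -/
def sqRad (p : {p : ℤ × ℤ // p ≠ (0, 0)}) : ℕ := (p.1.1 ^ 2 + p.1.2 ^ 2).natAbs

lemma sqRad_cast (p : {p : ℤ × ℤ // p ≠ (0, 0)}) :
    (sqRad p : ℤ) = p.1.1 ^ 2 + p.1.2 ^ 2 :=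
  Int.natAbs_of_nonneg (by positivity)

lemma sqRad_ne_zero (p : {p : ℤ × ℤ // p ≠ (0, 0)}) : sqRad p ≠ 0 := by
  intro h
  have h2 := sqRad_cast p
  rw [h] at h2
  apply p.2
  have hx : p.1.1 = 0 := by push_cast at h2; nlinarith [sq_nonneg p.1.1, sq_nonneg p.1.2]
  have hy : p.1.2 = 0 := by push_cast at h2; nlinarith [sq_nonneg p.1.1, sq_nonneg p.1.2]
  exact Prod.ext hx hy

/-- The fibres of the squared radius are the circles. -/
def fibEquiv (n : ℕ) (hn : n ≠ 0) : {p // sqRad p = n} ≃ circPts n where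
  toFun p := ⟨p.1.1, by
    show p.1.1.1 ^ 2 + p.1.1.2 ^ 2 = (n : ℤ)
    rw [← sqRad_cast, p.2]⟩
  invFun z := ⟨⟨z.1, by
      rintro h
      have h2 : z.1.1 ^ 2 + z.1.2 ^ 2 = (n : ℤ) := z.2
      rw [h] at h2
      apply hn
      simpa using h2.symm⟩, by
      have h2 : z.1.1 ^ 2 + z.1.2 ^ 2 = (n : ℤ) := z.2
      simp [sqRad, h2]⟩
  left_inv p := rfl
  right_inv z := rfl

lemma fib_finite (n : ℕ) : Finite {p // sqRad p = n} := by
  by_cases hn : n = 0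
  · subst hn
    have : IsEmpty {p // sqRad p = 0} := ⟨fun p => sqRad_ne_zero p.1 p.2⟩
    infer_instance
  · haveI := (circPts_finite n).to_subtype
    exact Finite.of_equiv _ (fibEquiv n hn).symm

lemma fib_card (n : ℕ) (hn : n ≠ 0) : Nat.card {p // sqRad p = n} = (circPts n).ncard := by
  rw [Nat.card_congr (fibEquiv n hn)]; rfl

lemma lseries_hasSum (s : ℂ) (hs : 1 < s.re) :
    HasSum (fun n : ℕ => (Nat.card {p // sqRad p = n} : ℂ) * (n : ℂ) ^ (-s))
      (4 * riemannZeta s * dirichletBeta s) := by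
  have h2 : LSeriesHasSum (fun n : ℕ => (ZMod.χ₄.ringHomComp (Int.castRingHom ℂ)) (n : ZMod 4)) s
      (dirichletBeta s) := by
    rw [dirichletBeta, DirichletCharacter.LFunction_eq_LSeries _ hs]
    exact (DirichletCharacter.LSeriesSummable_of_one_lt_re _ hs).LSeriesHasSum
  have h := (LSeriesHasSum.convolution (LSeriesHasSum_one hs) h2).mul_left 4
  rw [mul_assoc]
  refine h.congr_fun ?_
  intro n
  by_cases hn : n = 0
  · subst hn
    have : IsEmpty {p // sqRad p = 0} := ⟨fun p => sqRad_ne_zero p.1 p.2⟩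
    simp
  · have hj : (Nat.card {p // sqRad p = n} : ℂ) = 4 * (chiSum n : ℂ) := by
      rw [fib_card n hn]
      exact_mod_cast congrArg (Int.cast : ℤ → ℂ) (jacobi_two_sq n hn)
    rw [hj, LSeries.term_of_ne_zero hn, LSeries.convolution_def, Complex.cpow_neg, ← div_eq_mul_inv,
      mul_div_assoc]
    congr 2
    show (chiSum n : ℂ) = ∑ p ∈ n.divisorsAntidiagonal, (1 : ℕ → ℂ) p.1 *
      (ZMod.χ₄.ringHomComp (Int.castRingHom ℂ)) (p.2 : ZMod 4)
    rw [Nat.sum_divisorsAntidiagonal' (f := fun a b => (1 : ℕ → ℂ) a *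
      (ZMod.χ₄.ringHomComp (Int.castRingHom ℂ)) (b : ZMod 4))]
    simp [chiSum]

/-- For `Re(s) > 1`, the Epstein zeta series `Σ_{(m,n)≠(0,0)} (m² + n²)^{-s}` converges
and equals `4 ζ(s) L(s)`. -/
theorem epstein_zeta_eq (s : ℂ) (hs : 1 < s.re) :
    HasSum (fun p : {p : ℤ × ℤ // p ≠ (0, 0)} =>
        (((p.1.1 ^ 2 + p.1.2 ^ 2 : ℤ) : ℂ)) ^ (-s))
      (4 * riemannZeta s * dirichletBeta s) := by
  have hL := lseries_hasSum s hs
  have hterm : ∀ p : {p : ℤ × ℤ // p ≠ (0, 0)},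
      (((p.1.1 ^ 2 + p.1.2 ^ 2 : ℤ) : ℂ)) ^ (-s) = (sqRad p : ℂ) ^ (-s) := by
    intro p
    rw [← sqRad_cast]
    norm_cast
  simp only [hterm]
  rw [← (Equiv.sigmaFiberEquiv sqRad).hasSum_iff]
  have hval : ∀ (n : ℕ) (y : {p // sqRad p = n}),
      ((fun p => (sqRad p : ℂ) ^ (-s)) ∘ (Equiv.sigmaFiberEquiv sqRad)) ⟨n, y⟩
        = (n : ℂ) ^ (-s) := by
    intro n y
    simp [Equiv.sigmaFiberEquiv, y.2]
  refine HasSum.sigma_of_hasSum hL ?_ ?_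
  · intro n
    simp only [hval]
    haveI := fib_finite n
    haveI := Fintype.ofFinite {p // sqRad p = n}
    have := hasSum_fintype (fun _ : {p // sqRad p = n} => (n : ℂ) ^ (-s))
    simpa [Nat.card_eq_fintype_card] using this
  · rw [← summable_norm_iff, summable_sigma_of_nonneg (fun _ => norm_nonneg _)]
    simp only [hval]
    constructor
    · intro n
      haveI := fib_finite n
      exact Summable.of_finite
    · refine hL.summable.norm.congr ?_
      intro n
      haveI := fib_finite n
      haveI := Fintype.ofFinite {p // sqRad p = n}
      rw [tsum_fintype]
      simp [Nat.card_eq_fintype_card]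
end
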